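/- arXiv:0904.1916 — 2 statements merged into one kernel-verified Lean document; each statement's English description precedes it below -/
import Mathlib

section
/- Fix μ, λ ∈ ℂ. On B = ℂ[x₁, x₂, x₃, …] define, for n ≥ 1, a_n = ∂/∂x_n, a_{−n} = n x_n · (multiplication), and a_0 = μ·id, and define ℂ-linear operators L_k for k ∈ ℤ as follows. For k > 0: L_k = Σ_{j≥1} j x_j ∂/∂x_{j+k} + (1/2) Σ_{i=1}^{k−1} ∂²/∂x_i ∂x_{k−i} + (μ + iλk) ∂/∂x_k. For k < 0, writing k = −m with m > 0: L_{−m} = Σ_{j≥1} (j+m) x_{j+m} ∂/∂x_j + (1/2) Σ_{i=1}^{m−1} i(m−i) x_i x_{m−i} · + (μ − iλm) m x_m ·. For k = 0: L_0 = (μ² + λ²)/2 · id + Σ_{j≥1} j x_j ∂/∂x_j. (On each polynomial, all sums have only finitely many nonzero terms.) Then for all m, n ∈ ℤ, L_m ∘ L_n − L_n ∘ L_m = (m − n) L_{m+n} + δ_{m,−n} · ((m³ − m)/12) · (1 + 12λ²) · id; i.e., these operators form a representation of the Virasoro algebra with central charge c = 1 + 12λ². -/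
open MvPolynomial

/-- The normal-ordered oscillator (Fairlie) representation of the Virasoro generator `L_k`
on `B = ℂ[x₁, x₂, …]` (variables indexed by positive naturals; the variable `x_0` is unused),
built from the Heisenberg operators `a_n = ∂/∂x_n`, `a_{−n} = n x_n·` (n ≥ 1), `a_0 = μ`:

* for `k > 0` : `L_k = Σ_{j≥1} j x_j ∂/∂x_{j+k} + ½ Σ_{i=1}^{k−1} ∂²/∂x_i∂x_{k−i} + (μ + iλk) ∂/∂x_k`;
* for `k = −m < 0` : `L_{−m} = Σ_{j≥1} (j+m) x_{j+m} ∂/∂x_j + ½ Σ_{i=1}^{m−1} i(m−i) x_i x_{m−i}·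
  + (μ − iλm) m x_m·`;
* for `k = 0` : `L_0 = (μ² + λ²)/2 + Σ_{j≥1} j x_j ∂/∂x_j`.

On each polynomial only finitely many terms of the infinite sums are nonzero, so the sums are
taken as `finsum`s. -/
noncomputable def virasoroOsc (μ lam : ℂ) (k : ℤ) (p : MvPolynomial ℕ ℂ) : MvPolynomial ℕ ℂ :=
  if 0 < k then
    let m := k.toNat
    (∑ᶠ j ∈ Set.Ici (1 : ℕ), (j : ℂ) • (X j * pderiv (j + m) p))
      + (1 / 2 : ℂ) • ∑ i ∈ Finset.Ico 1 m, pderiv i (pderiv (m - i) p)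
      + (μ + Complex.I * lam * (m : ℂ)) • pderiv m p
  else if k < 0 then
    let m := (-k).toNat
    (∑ᶠ j ∈ Set.Ici (1 : ℕ), ((j + m : ℕ) : ℂ) • (X (j + m) * pderiv j p))
      + (1 / 2 : ℂ) • ∑ i ∈ Finset.Ico 1 m, ((i * (m - i) : ℕ) : ℂ) • (X i * (X (m - i) * p))
      + ((μ - Complex.I * lam * (m : ℂ)) * (m : ℂ)) • (X m * p)
  else
    ((μ ^ 2 + lam ^ 2) / 2) • p + ∑ᶠ j ∈ Set.Ici (1 : ℕ), (j : ℂ) • (X j * pderiv j p)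

namespace MvPolynomial

section General

variable {σ R : Type*} [CommRing R]

theorem mkDerivation_eq_finsum (f : σ → MvPolynomial σ R) (p : MvPolynomial σ R) :
    mkDerivation R f p = ∑ᶠ i, f i * pderiv i p := by
  classical
  have hsum (q : MvPolynomial σ R) :
      (∑ i ∈ p.vars, f i • pderiv (R := R) i) q = ∑ i ∈ p.vars, f i * pderiv i q := by
    rw [← Derivation.coeFnAddMonoidHom_apply, map_sum, Finset.sum_apply]
    rfl
  rw [finsum_eq_sum_of_support_subset (s := p.vars)]
  · have h : mkDerivation R f p = (∑ i ∈ p.vars, f i • pderiv (R := R) i) p := by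
      refine derivation_eq_of_forall_mem_vars fun j hj => ?_
      rw [hsum, Finset.sum_eq_single j]
      · simp
      · intro i _ hij
        simp [pderiv_X_of_ne hij.symm]
      · exact fun h => absurd hj h
    rw [h, hsum]
  · intro i hi
    by_contra h
    exact hi (by simp [pderiv_eq_zero_of_notMem_vars h])

theorem mkDerivation_eq_finsum_mem {ι : Type*} (f : σ → MvPolynomial σ R) (s : Set ι) (g : ι → σ)
    (hg : s.InjOn g) (hf : ∀ i ∉ g '' s, f i = 0) (p : MvPolynomial σ R) :
    mkDerivation R f p = ∑ᶠ j ∈ s, f (g j) * pderiv (g j) p := by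
  rw [mkDerivation_eq_finsum, ← finsum_mem_image (f := fun i => f i * pderiv i p) hg,
    finsum_mem_def]
  refine finsum_congr fun i => ?_
  by_cases hi : i ∈ g '' s
  · rw [Set.indicator_of_mem hi]
  · rw [Set.indicator_of_notMem hi, hf i hi, zero_mul]

theorem constantCoeff_derivation (D : Derivation R (MvPolynomial σ R) (MvPolynomial σ R))
    (hD : ∀ i, constantCoeff (D (X i)) = 0) (p : MvPolynomial σ R) :
    constantCoeff (D p) = 0 := by
  induction p using MvPolynomial.induction_on with
  | C a => simp
  | add p q hp hq => simp [hp, hq]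
  | mul_X p i hp => simp [hD]

theorem eq_C_of_forall_pderiv_eq_zero [IsDomain R] [CharZero R] (p : MvPolynomial σ R)
    (hp : ∀ i, pderiv i p = 0) : p = C (constantCoeff p) := by
  classical
  ext m
  rw [coeff_C]
  split_ifs with h
  · rw [← h, constantCoeff_eq]
  · obtain ⟨i, hi⟩ : ∃ i, m i ≠ 0 := by
      by_contra! h'
      exact h (Finsupp.ext fun i => (h' i).symm)
    have hle : Finsupp.single i 1 ≤ m := by
      rw [Finsupp.single_le_iff]; omega
    have := coeff_pderiv (i := i) p (m - Finsupp.single i 1)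
    rw [hp, tsub_add_cancel_of_le hle, coeff_zero] at this
    refine (mul_eq_zero.mp this.symm).resolve_right ?_
    exact Nat.cast_add_one_ne_zero _

/-- A linear endomorphism commuting with all multiplications by variables and all partial
derivatives is a scalar. -/
theorem linearMap_eq_smul_of_commute [IsDomain R] [CharZero R]
    (T : MvPolynomial σ R →ₗ[R] MvPolynomial σ R) (hX : ∀ i p, T (X i * p) = X i * T p)
    (hd : ∀ i p, T (pderiv i p) = pderiv i (T p)) (p : MvPolynomial σ R) :
    T p = constantCoeff (T 1) • p := by
  have h1 : T 1 = C (constantCoeff (T 1)) :=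
    eq_C_of_forall_pderiv_eq_zero _ fun i => by rw [← hd]; simp
  induction p using MvPolynomial.induction_on with
  | C a =>
    rw [C_eq_smul_one, map_smul, h1, smul_comm, ← C_eq_smul_one, constantCoeff_C]
  | add p q hp hq => rw [map_add, hp, hq, smul_add]
  | mul_X p i hp => rw [mul_comm, hX, hp, mul_smul_comm]

theorem pderiv_pderiv_comm (i j : σ) (p : MvPolynomial σ R) :
    pderiv i (pderiv j p) = pderiv j (pderiv i p) := by
  classical
  ext m
  rw [coeff_pderiv, coeff_pderiv, coeff_pderiv, coeff_pderiv, add_right_comm]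
  by_cases h : i = j
  · rw [h]
  · simp [h, Ne.symm h]
    ring

end General

end MvPolynomial

/-- The part of `virasoroOsc μ lam k` that is a derivation, `∑ (i - k) x_{i-k} ∂/∂x_i` over the `i`
with `i` and `i - k` positive. -/
noncomputable def virasoroDerivation (k : ℤ) :
    Derivation ℂ (MvPolynomial ℕ ℂ) (MvPolynomial ℕ ℂ) :=
  mkDerivation ℂ fun i => if 0 < i ∧ k < i then (((i : ℤ) - k : ℤ) : ℂ) • X ((i : ℤ) - k).toNat
    else 0

theorem virasoroDerivation_X (k : ℤ) (i : ℕ) : virasoroDerivation k (X i) =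
    if 0 < i ∧ k < i then (((i : ℤ) - k : ℤ) : ℂ) • X ((i : ℤ) - k).toNat else 0 :=
  mkDerivation_X ..

theorem virasoroDerivation_natCast (m : ℕ) (p : MvPolynomial ℕ ℂ) :
    virasoroDerivation m p = ∑ᶠ j ∈ Set.Ici (1 : ℕ), (j : ℂ) • (X j * pderiv (j + m) p) := by
  rw [virasoroDerivation, mkDerivation_eq_finsum_mem _ (Set.Ici 1) (fun j => j + m)
    (add_left_injective m).injOn]
  · refine finsum_mem_congr rfl fun j (hj : 1 ≤ j) => ?_
    rw [if_pos (by omega)]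
    simp
  · intro i hi
    rw [if_neg]
    exact fun h => hi ⟨i - m, by simp; omega, by simp; omega⟩

theorem virasoroDerivation_neg_natCast (m : ℕ) (p : MvPolynomial ℕ ℂ) :
    virasoroDerivation (-m) p =
      ∑ᶠ j ∈ Set.Ici (1 : ℕ), ((j + m : ℕ) : ℂ) • (X (j + m) * pderiv j p) := by
  rw [virasoroDerivation, mkDerivation_eq_finsum_mem _ (Set.Ici 1) id
    Function.injective_id.injOn]
  · refine finsum_mem_congr rfl fun j (hj : 1 ≤ j) => ?_
    rw [if_pos (by simp; omega)]
    have : ((j : ℤ) - -(m : ℤ)) = ((j + m : ℕ) : ℤ) := by push_cast; ring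
    rw [id, this, Int.toNat_natCast, Int.cast_natCast, smul_mul_assoc]
  · intro i hi
    rw [if_neg]
    exact fun h => hi ⟨i, by simp; omega, rfl⟩

theorem virasoroDerivation_pderiv (k : ℤ) (r : ℕ) (p : MvPolynomial ℕ ℂ) :
    virasoroDerivation k (pderiv r p) = pderiv r (virasoroDerivation k p)
      - if 0 < k + r then (r : ℂ) • pderiv (k + r).toNat p else 0 := by
  have h : ⁅virasoroDerivation k, pderiv r⁆ =
      -if 0 < k + r then (r : ℂ) • pderiv (R := ℂ) (k + r).toNat else 0 := by
    ext1 i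
    rw [Derivation.commutator_apply, pderiv_X, virasoroDerivation_X]
    by_cases hk : 0 < k + r
    · by_cases hi : i = (k + r).toNat
      · subst hi
        rcases Nat.eq_zero_or_pos r with rfl | hr
        · rw [if_neg (by omega)]
          simp [Pi.single_apply]
          split_ifs <;> simp
        rw [if_pos (by omega), if_pos hk]
        have : (((k + r).toNat : ℤ) - k) = r := by omega
        rw [this]
        simp [Pi.single_apply]
        split_ifs <;> simp
      · rw [if_pos hk]
        have : ¬ (0 < i ∧ k < i ∧ ((i : ℤ) - k).toNat = r) := by omega
        simp [Pi.single_apply, hi]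
        split_ifs <;> simp [Pi.single_apply] <;> grind
    · rw [if_neg hk]
      have : ¬ (0 < i ∧ k < i ∧ ((i : ℤ) - k).toNat = r) := by omega
      simp [Pi.single_apply]
      split_ifs <;> simp [Pi.single_apply] <;> grind
  have h' := congrArg (fun D => D p) h
  simp only [Derivation.commutator_apply] at h'
  rw [sub_eq_iff_eq_add'.mp h', sub_eq_add_neg]
  split_ifs <;> simp

theorem constantCoeff_virasoroDerivation (k : ℤ) (p : MvPolynomial ℕ ℂ) :
    constantCoeff (virasoroDerivation k p) = 0 := by
  refine constantCoeff_derivation _ (fun i => ?_) p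
  rw [virasoroDerivation_X]
  split_ifs <;> simp

theorem virasoroOsc_natCast (μ lam : ℂ) {m : ℕ} (hm : 0 < m) (p : MvPolynomial ℕ ℂ) :
    virasoroOsc μ lam m p = virasoroDerivation m p
      + (1 / 2 : ℂ) • ∑ i ∈ Finset.Ico 1 m, pderiv i (pderiv (m - i) p)
      + (μ + Complex.I * lam * (m : ℂ)) • pderiv m p := by
  rw [virasoroOsc, if_pos (by omega), virasoroDerivation_natCast]
  simp only [Int.toNat_natCast]

/-- The polynomial `∑_{0 < i < m} i (m - i) x_i x_{m-i}`. -/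
noncomputable def currentSquare (m : ℕ) : MvPolynomial ℕ ℂ :=
  ∑ i ∈ Finset.Ico 1 m, ((i * (m - i) : ℕ) : ℂ) • (X i * X (m - i))

theorem virasoroOsc_neg_natCast (μ lam : ℂ) {m : ℕ} (hm : 0 < m) (p : MvPolynomial ℕ ℂ) :
    virasoroOsc μ lam (-m) p = virasoroDerivation (-m) p
      + ((1 / 2 : ℂ) • currentSquare m + ((μ - Complex.I * lam * (m : ℂ)) * m) • X m) * p := by
  rw [virasoroOsc, if_neg (by omega), if_pos (by omega), virasoroDerivation_neg_natCast,
    currentSquare]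
  simp only [neg_neg, Int.toNat_natCast, add_mul, smul_mul_assoc, Finset.sum_mul, mul_assoc,
    add_assoc]

theorem virasoroOsc_zero (μ lam : ℂ) (p : MvPolynomial ℕ ℂ) :
    virasoroOsc μ lam 0 p = virasoroDerivation 0 p + ((μ ^ 2 + lam ^ 2) / 2) • p := by
  have h := virasoroDerivation_natCast 0 p
  simp only [Nat.cast_zero, add_zero] at h
  rw [virasoroOsc, if_neg (lt_irrefl _), if_neg (lt_irrefl _), h, add_comm]

theorem Int.eq_zero_or_natCast_or_neg (k : ℤ) :
    k = 0 ∨ (∃ m : ℕ, 0 < m ∧ k = m) ∨ ∃ m : ℕ, 0 < m ∧ k = -m := by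
  rcases lt_trichotomy k 0 with h | h | h
  · exact Or.inr (Or.inr ⟨(-k).toNat, by omega, by omega⟩)
  · exact Or.inl h
  · exact Or.inr (Or.inl ⟨k.toNat, by omega, by omega⟩)

/-- `virasoroOsc μ lam k` as a linear endomorphism. -/
noncomputable def virasoroEnd (μ lam : ℂ) (k : ℤ) : Module.End ℂ (MvPolynomial ℕ ℂ) where
  toFun := virasoroOsc μ lam k
  map_add' p q := by
    rcases k.eq_zero_or_natCast_or_neg with rfl | ⟨m, hm, rfl⟩ | ⟨m, hm, rfl⟩
    · simp only [virasoroOsc_zero, map_add, smul_add]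
      abel
    · simp only [virasoroOsc_natCast _ _ hm, map_add, smul_add, Finset.sum_add_distrib]
      abel
    · simp only [virasoroOsc_neg_natCast _ _ hm, map_add, mul_add]
      abel
  map_smul' c p := by
    rcases k.eq_zero_or_natCast_or_neg with rfl | ⟨m, hm, rfl⟩ | ⟨m, hm, rfl⟩
    · simp only [virasoroOsc_zero, Derivation.map_smul, smul_add, smul_comm c, RingHom.id_apply]
    · simp only [virasoroOsc_natCast _ _ hm, Derivation.map_smul, smul_add, smul_comm c,
        ← Finset.smul_sum, RingHom.id_apply]
    · simp only [virasoroOsc_neg_natCast _ _ hm, Derivation.map_smul, smul_add, mul_smul_comm,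
        RingHom.id_apply]

theorem virasoroEnd_apply (μ lam : ℂ) (k : ℤ) (p : MvPolynomial ℕ ℂ) :
    virasoroEnd μ lam k p = virasoroOsc μ lam k p := rfl

theorem pderiv_currentSquare (m r : ℕ) : pderiv r (currentSquare m) =
    if r < m then (2 * r * ((m - r : ℕ) : ℂ)) • X (m - r) else 0 := by
  have h : ∀ i ∈ Finset.Ico 1 m,
      pderiv r (((i * (m - i) : ℕ) : ℂ) • (X i * X (m - i) : MvPolynomial ℕ ℂ)) =
        (if i = r then ((r * (m - r) : ℕ) : ℂ) • X (m - r) else 0)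
        + if i = m - r then ((r * (m - r) : ℕ) : ℂ) • X (m - r) else 0 := by
    intro i hi
    rw [Finset.mem_Ico] at hi
    rw [Derivation.map_smul, pderiv_mul, pderiv_X, pderiv_X, smul_add, Pi.single_apply,
      Pi.single_apply]
    congr 1
    · split_ifs with h
      · rw [h, one_mul]
      · simp
    · by_cases h : i = m - r
      · have hr : r = m - i := by omega
        rw [if_pos hr.symm, if_pos h, mul_one, ← h, ← hr, mul_comm i]
      · rw [if_neg h, if_neg (by omega)]
        simp
  rw [currentSquare, map_sum, Finset.sum_congr rfl h, Finset.sum_add_distrib, Finset.sum_ite_eq',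
    Finset.sum_ite_eq']
  rcases Nat.eq_zero_or_pos r with rfl | hr
  · simp
  · by_cases hm : r < m
    · rw [if_pos (by simp; omega), if_pos (by simp; omega), if_pos hm, ← add_smul]
      push_cast
      congr 1
      ring
    · rw [if_neg (by simp; omega), if_neg (by simp; omega), if_neg hm, add_zero]

theorem sum_pderiv_pderiv_X_mul (m s : ℕ) (p : MvPolynomial ℕ ℂ) :
    ∑ i ∈ Finset.Ico 1 m, pderiv i (pderiv (m - i) (X s * p)) =
      X s * ∑ i ∈ Finset.Ico 1 m, pderiv i (pderiv (m - i) p)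
        + if 0 < s ∧ s < m then (2 : ℂ) • pderiv (m - s) p else 0 := by
  have h : ∀ i ∈ Finset.Ico 1 m, pderiv i (pderiv (m - i) (X s * p)) =
      X s * pderiv i (pderiv (m - i) p) + ((if i = s then pderiv (m - s) p else 0)
        + if i = m - s then pderiv (m - s) p else 0) := by
    intro i hi
    rw [Finset.mem_Ico] at hi
    rw [pderiv_mul, pderiv_X, map_add, pderiv_mul, pderiv_mul, pderiv_X, Pi.single_apply,
      Pi.single_apply]
    have h1 : pderiv i (if s = m - i then (1 : MvPolynomial ℕ ℂ) else 0) = 0 := by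
      split_ifs <;> simp
    rw [h1]
    by_cases h2 : s = i <;> by_cases h3 : s = m - i
    · have : i = m - s := by omega
      simp [← h2, ← this]; ring
    · have : i ≠ m - s := by omega
      simp [h2, h2 ▸ h3]; ring
    · have : i = m - s := by omega
      have h4 : i ≠ s := Ne.symm h2
      rw [if_pos h3, if_neg h2, if_neg h4, if_pos this, ← this]
      ring
    · have : i ≠ m - s := by omega
      have h4 : i ≠ s := Ne.symm h2
      rw [if_neg h3, if_neg h2, if_neg h4, if_neg this]
      ring
  rw [Finset.sum_congr rfl h, Finset.sum_add_distrib, Finset.sum_add_distrib, Finset.sum_ite_eq',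
    Finset.sum_ite_eq', Finset.mul_sum]
  congr 1
  by_cases hm : 0 < s ∧ s < m
  · rw [if_pos (by simp; omega), if_pos (by simp; omega), if_pos hm, two_smul]
  · rw [if_neg (by simp; omega), if_neg (by simp; omega), if_neg hm, add_zero]

theorem virasoroOsc_natCast_pderiv (μ lam : ℂ) {m : ℕ} (hm : 0 < m) (s : ℕ)
    (p : MvPolynomial ℕ ℂ) : virasoroOsc μ lam m (pderiv s p) =
      pderiv s (virasoroOsc μ lam m p) - (s : ℂ) • pderiv (m + s) p := by
  have h : ((m : ℤ) + s).toNat = m + s := by omega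
  simp only [virasoroOsc_natCast _ _ hm, virasoroDerivation_pderiv, map_add, Derivation.map_smul,
    map_sum, pderiv_pderiv_comm s, h]
  rw [if_pos (by omega)]
  abel

theorem virasoroOsc_natCast_X_mul (μ lam : ℂ) {m : ℕ} (hm : 0 < m) (s : ℕ)
    (p : MvPolynomial ℕ ℂ) : virasoroOsc μ lam m (X s * p) = X s * virasoroOsc μ lam m p +
      if s = 0 then 0 else if m < s then ((s - m : ℕ) : ℂ) • (X (s - m) * p)
      else if s < m then pderiv (m - s) p else (μ + Complex.I * lam * m) • p := by
  rw [virasoroOsc_natCast _ _ hm, virasoroOsc_natCast _ _ hm, sum_pderiv_pderiv_X_mul]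
  simp only [Derivation.leibniz, smul_eq_mul,
    virasoroDerivation_X, pderiv_X, Pi.single_apply, Nat.cast_lt]
  rcases Nat.eq_zero_or_pos s with rfl | hs
  · simp [hm.ne]
    simp only [mul_add, mul_smul_comm]
  rw [if_neg hs.ne']
  rcases lt_trichotomy s m with h | rfl | h
  · simp [h, hs, h.not_gt, h.ne, smul_smul]
    simp only [mul_add, mul_smul_comm]
    abel
  · simp [hs]
    simp only [mul_add, mul_smul_comm]
    abel
  · have h1 : ((s : ℤ) - m) = ((s - m : ℕ) : ℤ) := by omega
    rw [h1]
    simp [h, hs, h.not_gt, h.ne', -Nat.cast_sub]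
    simp only [mul_add, mul_smul_comm, mul_comm p]
    abel

theorem virasoroOsc_neg_natCast_pderiv (μ lam : ℂ) {m : ℕ} (hm : 0 < m) (s : ℕ)
    (p : MvPolynomial ℕ ℂ) : virasoroOsc μ lam (-m) (pderiv s p) =
      pderiv s (virasoroOsc μ lam (-m) p) - if m < s then (s : ℂ) • pderiv (s - m) p
      else if s < m then (s * ((m - s : ℕ) : ℂ)) • (X (m - s) * p)
      else ((μ - Complex.I * lam * m) * m) • p := by
  simp only [virasoroOsc_neg_natCast _ _ hm, virasoroDerivation_pderiv, map_add,
    Derivation.map_smul, pderiv_mul, pderiv_currentSquare, pderiv_X, Pi.single_apply]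
  rcases lt_trichotomy s m with h | rfl | h
  · rw [if_neg (by omega), if_pos h, if_neg (by omega), if_neg (by omega), if_pos h, smul_smul,
      smul_zero, add_zero, smul_mul_assoc, show (1 / 2 : ℂ) * (2 * s * ((m - s : ℕ) : ℂ)) =
      s * ((m - s : ℕ) : ℂ) by ring]
    abel
  · simp
    abel
  · rw [if_pos (by omega), if_neg (by omega), if_neg (by omega), if_pos h,
      show (-(m : ℤ) + s).toNat = s - m by omega]
    simp
    abel

theorem virasoroOsc_neg_natCast_X_mul (μ lam : ℂ) {m : ℕ} (hm : 0 < m) (s : ℕ)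
    (p : MvPolynomial ℕ ℂ) : virasoroOsc μ lam (-m) (X s * p) = X s * virasoroOsc μ lam (-m) p +
      if s = 0 then 0 else ((s + m : ℕ) : ℂ) • (X (s + m) * p) := by
  simp only [virasoroOsc_neg_natCast _ _ hm, Derivation.leibniz, smul_eq_mul,
    virasoroDerivation_X]
  rcases Nat.eq_zero_or_pos s with rfl | hs
  · simp
    ring
  · have h1 : ((s : ℤ) - -m) = ((s + m : ℕ) : ℤ) := by omega
    rw [if_pos (by omega), if_neg hs.ne', h1, Int.toNat_natCast, Int.cast_natCast, mul_smul_comm,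
      mul_comm p]
    ring

theorem virasoroOsc_zero_pderiv (μ lam : ℂ) (s : ℕ) (p : MvPolynomial ℕ ℂ) :
    virasoroOsc μ lam 0 (pderiv s p) =
      pderiv s (virasoroOsc μ lam 0 p) - (s : ℂ) • pderiv s p := by
  simp only [virasoroOsc_zero, virasoroDerivation_pderiv, map_add, Derivation.map_smul, zero_add,
    Int.toNat_natCast]
  rcases Nat.eq_zero_or_pos s with rfl | hs
  · simp
  · rw [if_pos (by omega)]
    abel

theorem virasoroOsc_zero_X_mul (μ lam : ℂ) (s : ℕ) (p : MvPolynomial ℕ ℂ) :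
    virasoroOsc μ lam 0 (X s * p) = X s * virasoroOsc μ lam 0 p + (s : ℂ) • (X s * p) := by
  simp only [virasoroOsc_zero, Derivation.leibniz, smul_eq_mul, virasoroDerivation_X]
  rcases Nat.eq_zero_or_pos s with rfl | hs
  · simp [mul_add]
  · rw [if_pos (by omega), sub_zero, Int.toNat_natCast, Int.cast_natCast, mul_smul_comm,
      mul_comm p, mul_add, mul_smul_comm]
    abel

/-- The Heisenberg operators: `∂/∂x_n` for `n > 0`, multiplication by `-n x_{-n}` for `n < 0`,
and the scalar `μ` for `n = 0`. -/
noncomputable def heisenberg (μ : ℂ) (n : ℤ) : Module.End ℂ (MvPolynomial ℕ ℂ) :=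
  if 0 < n then (pderiv n.toNat : Derivation ℂ (MvPolynomial ℕ ℂ) (MvPolynomial ℕ ℂ))
  else if n < 0 then (-n : ℂ) • LinearMap.mulLeft ℂ (X (-n).toNat)
  else μ • 1

theorem heisenberg_natCast (μ : ℂ) {n : ℕ} (hn : 0 < n) (p : MvPolynomial ℕ ℂ) :
    heisenberg μ n p = pderiv n p := by
  rw [heisenberg, if_pos (by omega), Int.toNat_natCast]
  rfl

theorem heisenberg_neg_natCast (μ : ℂ) {n : ℕ} (hn : 0 < n) (p : MvPolynomial ℕ ℂ) :
    heisenberg μ (-n) p = (n : ℂ) • (X n * p) := by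
  rw [heisenberg, if_neg (by omega), if_pos (by omega)]
  simp

theorem heisenberg_zero (μ : ℂ) (p : MvPolynomial ℕ ℂ) : heisenberg μ 0 p = μ • p := by
  simp [heisenberg]

theorem lie_virasoroEnd_heisenberg (μ lam : ℂ) (k r : ℤ) :
    ⁅virasoroEnd μ lam k, heisenberg μ r⁆ = (-r : ℂ) • heisenberg μ (k + r)
      + (if k + r = 0 then Complex.I * lam * k ^ 2 else 0) • 1 := by
  refine LinearMap.ext fun p => ?_
  suffices h : virasoroEnd μ lam k (heisenberg μ r p) = heisenberg μ r (virasoroEnd μ lam k p)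
      + ((-r : ℂ) • heisenberg μ (k + r) p
        + (if k + r = 0 then Complex.I * lam * k ^ 2 else 0) • p) by
    rw [Ring.lie_def]
    exact sub_eq_iff_eq_add'.mpr h
  rcases r.eq_zero_or_natCast_or_neg with rfl | ⟨s, hs, rfl⟩ | ⟨s, hs, rfl⟩
  · rw [heisenberg_zero, heisenberg_zero, map_smul]
    split_ifs with h
    · obtain rfl : k = 0 := by omega
      simp
    · simp
  · rw [heisenberg_natCast _ hs, heisenberg_natCast _ hs]
    simp only [virasoroEnd_apply]
    rcases k.eq_zero_or_natCast_or_neg with rfl | ⟨m, hm, rfl⟩ | ⟨m, hm, rfl⟩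
    · rw [virasoroOsc_zero_pderiv, zero_add, heisenberg_natCast _ hs, if_neg (by omega)]
      simp [sub_eq_add_neg]
    · rw [virasoroOsc_natCast_pderiv _ _ hm, if_neg (by omega), ← Nat.cast_add,
        heisenberg_natCast _ (by omega)]
      simp [sub_eq_add_neg]
    · rw [virasoroOsc_neg_natCast_pderiv _ _ hm, sub_eq_add_neg]
      congr 1
      rcases lt_trichotomy s m with h | rfl | h
      · rw [if_neg (by omega), if_pos h, if_neg (by omega),
          show -(m : ℤ) + s = -(m - s : ℕ) by omega, heisenberg_neg_natCast _ (by omega), smul_smul]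
        simp [-Nat.cast_sub]
      · rw [if_neg (by omega), if_neg (by omega), if_pos (by omega), neg_add_cancel,
          heisenberg_zero, smul_smul, ← add_smul, ← neg_smul]
        congr 1
        push_cast
        ring
      · rw [if_pos h, if_neg (by omega), show -(m : ℤ) + s = (s - m : ℕ) by omega,
          heisenberg_natCast _ (by omega)]
        simp
  · rw [heisenberg_neg_natCast _ hs, heisenberg_neg_natCast _ hs, map_smul]
    simp only [virasoroEnd_apply]
    rcases k.eq_zero_or_natCast_or_neg with rfl | ⟨m, hm, rfl⟩ | ⟨m, hm, rfl⟩
    · rw [virasoroOsc_zero_X_mul, zero_add, heisenberg_neg_natCast _ hs, if_neg (by omega)]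
      simp
    · rw [virasoroOsc_natCast_X_mul _ _ hm, if_neg hs.ne', smul_add]
      congr 1
      rcases lt_trichotomy s m with h | rfl | h
      · rw [if_neg (by omega), if_pos h, if_neg (by omega),
          show (m : ℤ) + -s = (m - s : ℕ) by omega, heisenberg_natCast _ (by omega)]
        simp
      · rw [if_neg (by omega), if_neg (by omega), if_pos (by omega), add_neg_cancel,
          heisenberg_zero, smul_smul, smul_smul, ← add_smul]
        congr 1
        push_cast
        ring
      · rw [if_pos h, if_neg (by omega), show (m : ℤ) + -s = -(s - m : ℕ) by omega,
          heisenberg_neg_natCast _ (by omega)]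
        simp
    · rw [virasoroOsc_neg_natCast_X_mul _ _ hm, if_neg hs.ne', if_neg (by omega),
        show -(m : ℤ) + -s = -(s + m : ℕ) by omega, heisenberg_neg_natCast _ (by omega)]
      simp

/-- The operator `[L_m, L_n] - (m - n) L_{m+n}`. -/
noncomputable def virasoroDefect (μ lam : ℂ) (m n : ℤ) : Module.End ℂ (MvPolynomial ℕ ℂ) :=
  ⁅virasoroEnd μ lam m, virasoroEnd μ lam n⁆ - (m - n : ℂ) • virasoroEnd μ lam (m + n)

theorem virasoroDefect_apply (μ lam : ℂ) (m n : ℤ) (p : MvPolynomial ℕ ℂ) :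
    virasoroDefect μ lam m n p = virasoroOsc μ lam m (virasoroOsc μ lam n p)
      - virasoroOsc μ lam n (virasoroOsc μ lam m p)
      - ((m : ℂ) - n) • virasoroOsc μ lam (m + n) p := rfl

attribute [local instance] LieRing.ofAssociativeRing

theorem lie_virasoroDefect_heisenberg (μ lam : ℂ) (m n r : ℤ) :
    ⁅virasoroDefect μ lam m n, heisenberg μ r⁆ = 0 := by
  have lie_scalar (T : Module.End ℂ (MvPolynomial ℕ ℂ)) (c : ℂ) :
      ⁅T, c • (1 : Module.End ℂ (MvPolynomial ℕ ℂ))⁆ = 0 := by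
    rw [Ring.lie_def, mul_smul_comm, smul_mul_assoc, mul_one, one_mul, sub_self]
  have smul_left (c : ℂ) (S T : Module.End ℂ (MvPolynomial ℕ ℂ)) : ⁅c • S, T⁆ = c • ⁅S, T⁆ := by
    rw [Ring.lie_def, mul_smul_comm, smul_mul_assoc, Ring.lie_def, smul_sub]
  have smul_right (c : ℂ) (S T : Module.End ℂ (MvPolynomial ℕ ℂ)) : ⁅S, c • T⁆ = c • ⁅S, T⁆ := by
    rw [Ring.lie_def, mul_smul_comm, smul_mul_assoc, Ring.lie_def, smul_sub]
  simp only [virasoroDefect, sub_lie, smul_left, lie_lie, lie_virasoroEnd_heisenberg, lie_add,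
    smul_right _ (virasoroEnd _ _ _) (heisenberg _ _), lie_scalar, add_zero]
  rw [← add_assoc m n r, ← add_assoc n m r, add_comm n m]
  by_cases h : m + n + r = 0
  · obtain rfl : r = -(m + n) := by omega
    simp only [add_neg_cancel, if_true]
    push_cast
    module
  · simp only [if_neg h]
    push_cast
    module

theorem virasoroDefect_X_mul (μ lam : ℂ) (m n : ℤ) (s : ℕ) (p : MvPolynomial ℕ ℂ) :
    virasoroDefect μ lam m n (X s * p) = X s * virasoroDefect μ lam m n p := by
  rcases Nat.eq_zero_or_pos s with rfl | hs
  · have h (k : ℤ) (q : MvPolynomial ℕ ℂ) :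
        virasoroOsc μ lam k (X 0 * q) = X 0 * virasoroOsc μ lam k q := by
      rcases k.eq_zero_or_natCast_or_neg with rfl | ⟨m, hm, rfl⟩ | ⟨m, hm, rfl⟩
      · simp [virasoroOsc_zero_X_mul]
      · simp [virasoroOsc_natCast_X_mul _ _ hm]
      · simp [virasoroOsc_neg_natCast_X_mul _ _ hm]
    simp only [virasoroDefect_apply, h, mul_sub, mul_smul_comm]
  · have h := LinearMap.congr_fun (lie_virasoroDefect_heisenberg μ lam m n (-s)) p
    rw [Ring.lie_def] at h
    have h' := sub_eq_zero.mp h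
    simp only [Module.End.mul_apply, heisenberg_neg_natCast _ hs, map_smul] at h'
    exact smul_right_injective _ (Nat.cast_ne_zero.mpr hs.ne' : (s : ℂ) ≠ 0) h'

theorem virasoroDefect_pderiv (μ lam : ℂ) (m n : ℤ) (s : ℕ) (p : MvPolynomial ℕ ℂ) :
    virasoroDefect μ lam m n (pderiv s p) = pderiv s (virasoroDefect μ lam m n p) := by
  rcases Nat.eq_zero_or_pos s with rfl | hs
  · have h (k : ℤ) (q : MvPolynomial ℕ ℂ) :
        virasoroOsc μ lam k (pderiv 0 q) = pderiv 0 (virasoroOsc μ lam k q) := by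
      rcases k.eq_zero_or_natCast_or_neg with rfl | ⟨m, hm, rfl⟩ | ⟨m, hm, rfl⟩
      · simp [virasoroOsc_zero_pderiv]
      · simp [virasoroOsc_natCast_pderiv _ _ hm]
      · simp [virasoroOsc_neg_natCast_pderiv _ _ hm, hm]
    simp only [virasoroDefect_apply, h, map_sub, Derivation.map_smul]
  · have h := LinearMap.congr_fun (lie_virasoroDefect_heisenberg μ lam m n s) p
    rw [Ring.lie_def] at h
    have h' := sub_eq_zero.mp h
    simpa only [Module.End.mul_apply, heisenberg_natCast _ hs] using h'

theorem constantCoeff_virasoroOsc_neg (μ lam : ℂ) {k : ℤ} (hk : k < 0) (p : MvPolynomial ℕ ℂ) :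
    constantCoeff (virasoroOsc μ lam k p) = 0 := by
  obtain ⟨m, rfl⟩ : ∃ m : ℕ, k = -m := ⟨(-k).toNat, by omega⟩
  rw [virasoroOsc_neg_natCast _ _ (by omega)]
  simp [constantCoeff_virasoroDerivation, currentSquare]

theorem constantCoeff_virasoroOsc_zero (μ lam : ℂ) (p : MvPolynomial ℕ ℂ) :
    constantCoeff (virasoroOsc μ lam 0 p) = (μ ^ 2 + lam ^ 2) / 2 * constantCoeff p := by
  simp [virasoroOsc_zero, constantCoeff_virasoroDerivation]

theorem virasoroOsc_pos_one (μ lam : ℂ) {k : ℤ} (hk : 0 < k) : virasoroOsc μ lam k 1 = 0 := by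
  obtain ⟨m, rfl⟩ : ∃ m : ℕ, k = m := ⟨k.toNat, by omega⟩
  rw [virasoroOsc_natCast _ _ (by omega)]
  simp

theorem virasoroOsc_zero_one (μ lam : ℂ) :
    virasoroOsc μ lam 0 1 = ((μ ^ 2 + lam ^ 2) / 2) • 1 := by
  simp [virasoroOsc_zero]

theorem sum_Ico_mul_sub (m : ℕ) (hm : 0 < m) :
    ∑ i ∈ Finset.Ico 1 m, ((i : ℂ) * ((m - i : ℕ) : ℂ)) = ((m : ℂ) ^ 3 - m) / 6 := by
  have h (c : ℂ) (n : ℕ) : ∑ i ∈ Finset.range n, (i : ℂ) * (c - i) =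
      c * (n * (n - 1) / 2) - (n - 1) * n * (2 * n - 1) / 6 := by
    induction n with
    | zero => simp
    | succ n ih =>
      rw [Finset.sum_range_succ, ih]
      push_cast
      ring
  have h2 : ∑ i ∈ Finset.Ico 1 m, ((i : ℂ) * ((m - i : ℕ) : ℂ)) =
      ∑ i ∈ Finset.range m, (i : ℂ) * (m - i) := by
    rw [Finset.range_eq_Ico, Finset.sum_eq_sum_Ico_succ_bot hm]
    simp only [Nat.cast_zero, zero_mul, zero_add]
    refine Finset.sum_congr rfl fun i hi => ?_
    rw [Nat.cast_sub (Finset.mem_Ico.mp hi).2.le]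
  rw [h2, h]
  ring

theorem constantCoeff_virasoroOsc_virasoroOsc_one (μ lam : ℂ) {m k : ℕ} (hm : 0 < m)
    (hk : 0 < k) : constantCoeff (virasoroOsc μ lam m (virasoroOsc μ lam (-k) 1)) =
      if m = k then ((m : ℂ) ^ 3 - m) / 12 + m * (μ ^ 2 + lam ^ 2 * m ^ 2) else 0 := by
  have h1 : ∀ i ∈ Finset.Ico 1 m, constantCoeff (pderiv i (pderiv (m - i)
      ((1 / 2 : ℂ) • currentSquare k + ((μ - Complex.I * lam * (k : ℂ)) * k) • X k))) =
      if m = k then (i : ℂ) * ((m - i : ℕ) : ℂ) else 0 := by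
    intro i hi
    rw [Finset.mem_Ico] at hi
    simp only [map_add, Derivation.map_smul, pderiv_currentSquare, pderiv_X, Pi.single_apply]
    have h0 : pderiv i (if k = m - i then (1 : MvPolynomial ℕ ℂ) else 0) = 0 := by
      split_ifs <;> simp
    rw [h0, smul_zero, map_zero, add_zero]
    by_cases hmk : m = k
    · subst hmk
      rw [if_pos (by omega), if_pos rfl, show m - (m - i) = i by omega]
      simp [-Nat.cast_sub]
      ring
    · rw [if_neg hmk]
      split_ifs with h
      · have : k - (m - i) ≠ i := by omega
        simp [pderiv_X_of_ne this]
      · simp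
  rw [virasoroOsc_neg_natCast _ _ hk, Derivation.map_one_eq_zero, zero_add, mul_one,
    virasoroOsc_natCast _ _ hm, map_add, map_add, constantCoeff_virasoroDerivation,
    constantCoeff_smul, map_sum, Finset.sum_congr rfl h1, constantCoeff_smul]
  simp only [map_add, Derivation.map_smul, pderiv_currentSquare, pderiv_X, Pi.single_apply]
  by_cases hmk : m = k
  · subst hmk
    simp only [if_true, sum_Ico_mul_sub m hm, lt_irrefl, if_false]
    simp
    linear_combination (-lam ^ 2 * m ^ 3) * Complex.I_sq
  · simp only [if_neg hmk, if_neg (Ne.symm hmk)]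
    split_ifs <;> simp

theorem constantCoeff_virasoroDefect_one_of_le (μ lam : ℂ) {m n : ℤ} (h : n ≤ m) :
    constantCoeff (virasoroDefect μ lam m n 1) =
      (if m = -n then (1 : ℂ) else 0) * (((m : ℂ) ^ 3 - (m : ℂ)) / 12) * (1 + 12 * lam ^ 2) := by
  have hsmul (k : ℤ) (c : ℂ) : virasoroOsc μ lam k (c • 1) = c • virasoroOsc μ lam k 1 :=
    (virasoroEnd μ lam k).map_smul c 1
  have hzero (k : ℤ) : virasoroOsc μ lam k 0 = 0 := (virasoroEnd μ lam k).map_zero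
  rw [virasoroDefect_apply]
  simp only [map_sub, constantCoeff_smul, smul_eq_mul]
  rcases lt_trichotomy n 0 with hn | rfl | hn
  · rcases lt_trichotomy m 0 with hm | rfl | hm
    · rw [if_neg (by omega), constantCoeff_virasoroOsc_neg _ _ hm,
        constantCoeff_virasoroOsc_neg _ _ hn, constantCoeff_virasoroOsc_neg _ _ (by omega)]
      ring
    · rw [constantCoeff_virasoroOsc_zero, zero_add]
      simp [constantCoeff_virasoroOsc_neg _ _ hn]
    · obtain ⟨a, rfl⟩ : ∃ a : ℕ, m = a := ⟨m.toNat, by omega⟩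
      obtain ⟨b, rfl⟩ : ∃ b : ℕ, n = -b := ⟨(-n).toNat, by omega⟩
      rw [constantCoeff_virasoroOsc_virasoroOsc_one _ _ (by omega) (by omega),
        constantCoeff_virasoroOsc_neg _ _ hn]
      by_cases hab : a = b
      · subst hab
        rw [if_pos rfl, if_pos (by omega), add_neg_cancel, virasoroOsc_zero_one]
        simp
        ring
      · rw [if_neg hab, if_neg (by omega)]
        rcases lt_or_gt_of_ne (show (a : ℤ) + -b ≠ 0 by omega) with h' | h'
        · rw [constantCoeff_virasoroOsc_neg _ _ h']
          ring
        · rw [virasoroOsc_pos_one _ _ h']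
          simp
  · rcases h.eq_or_lt with rfl | hm
    · simp
    · rw [if_neg (by omega), add_zero, virasoroOsc_zero_one, hsmul, virasoroOsc_pos_one _ _ hm,
        hzero]
      simp
  · rw [if_neg (by omega), virasoroOsc_pos_one _ _ hn, virasoroOsc_pos_one _ _ (by omega),
      virasoroOsc_pos_one _ _ (by omega), hzero, hzero]
    simp

theorem virasoroDefect_swap (μ lam : ℂ) (m n : ℤ) :
    virasoroDefect μ lam m n = -virasoroDefect μ lam n m := by
  rw [virasoroDefect, virasoroDefect, ← lie_skew, add_comm m n]
  module

theorem constantCoeff_virasoroDefect_one (μ lam : ℂ) (m n : ℤ) :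
    constantCoeff (virasoroDefect μ lam m n 1) =
      (if m = -n then (1 : ℂ) else 0) * (((m : ℂ) ^ 3 - (m : ℂ)) / 12) * (1 + 12 * lam ^ 2) := by
  rcases le_total n m with h | h
  · exact constantCoeff_virasoroDefect_one_of_le μ lam h
  · rw [virasoroDefect_swap, LinearMap.neg_apply, map_neg,
      constantCoeff_virasoroDefect_one_of_le μ lam h]
    by_cases hmn : m = -n
    · subst hmn
      simp
      ring
    · rw [if_neg hmn, if_neg (by omega)]
      ring

/-- The oscillator operators `L_k` on `B = ℂ[x₁, x₂, …]` satisfy the Virasoro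
commutation relations with central charge `c = 1 + 12λ²`:
`[L_m, L_n] = (m − n) L_{m+n} + δ_{m,−n} ((m³ − m)/12) (1 + 12λ²) · id`. -/
theorem virasoro_oscillator_representation (μ lam : ℂ) :
    ∀ (m n : ℤ) (p : MvPolynomial ℕ ℂ),
      virasoroOsc μ lam m (virasoroOsc μ lam n p) - virasoroOsc μ lam n (virasoroOsc μ lam m p)
        = ((m : ℂ) - (n : ℂ)) • virasoroOsc μ lam (m + n) p
          + ((if m = -n then (1 : ℂ) else 0) * (((m : ℂ) ^ 3 - (m : ℂ)) / 12)
              * (1 + 12 * lam ^ 2)) • p := by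
  intro m n p
  have h := linearMap_eq_smul_of_commute (virasoroDefect μ lam m n)
    (virasoroDefect_X_mul μ lam m n) (virasoroDefect_pderiv μ lam m n) p
  rw [constantCoeff_virasoroDefect_one, virasoroDefect_apply] at h
  exact sub_eq_iff_eq_add'.mp h
end

section
/- Let N ≥ 1. There exists a constant c_N ∈ ℂ, depending only on N, with the following property. Let H_N denote the real vector space of N×N complex Hermitian matrices, equipped with the Lebesgue measure dX obtained by identifying a Hermitian matrix X with the real coordinates (X_{ii})_{1≤i≤N} and (Re X_{ij}, Im X_{ij})_{1≤i<j≤N}. Let Φ : H_N → ℂ be a measurable function invariant under unitary conjugation (Φ(U X U*) = Φ(X) for all unitary U), let Y = diag(y₁, …, y_N) with y₁, …, y_N real and pairwise distinct, and assume X ↦ Φ(X) e^{−i tr(XY)} is integrable on H_N and d ↦ Φ(diag(d)) e^{−i Σ_j d_j y_j} V(d) is integrable on ℝ^N. Then ∫_{H_N} Φ(X) e^{−i \, tr(XY)} dX = c_N · V(Y)^{−1} · ∫_{ℝ^N} Φ(diag(d₁,…,d_N)) e^{−i Σ_{j=1}^N d_j y_j} V(d₁,…,d_N) \, dd₁⋯dd_N,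 where V(z₁,…,z_N) = ∏_{1≤i<j≤N}(z_j − z_i) is the Vandermonde determinant. -/
open MeasureTheory Matrix

/-- The Hermitian `N×N` matrix with diagonal entries `v.1 i` and, for `i < j`, entry
`(i,j)` equal to `Re + Im·I` given by the pair `v.2 ⟨(i,j), _⟩`.  This identifies the real
vector space `H_N` of Hermitian matrices with the coordinates `(X_{ii})_i`,
`(Re X_{ij}, Im X_{ij})_{i<j}`, and thereby endows `H_N` with Lebesgue measure. -/
noncomputable def hermMat (N : ℕ)
    (v : (Fin N → ℝ) × ({ p : Fin N × Fin N // p.1 < p.2 } → ℝ × ℝ)) :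
    Matrix (Fin N) (Fin N) ℂ :=
  Matrix.of fun i j =>
    if h : i < j then ((v.2 ⟨(i, j), h⟩).1 : ℂ) + (v.2 ⟨(i, j), h⟩).2 * Complex.I
    else if h' : j < i then ((v.2 ⟨(j, i), h'⟩).1 : ℂ) - (v.2 ⟨(j, i), h'⟩).2 * Complex.I
    else (v.1 i : ℂ)

/-- The Vandermonde determinant `V(z₁,…,z_N) = ∏_{i<j} (z_j − z_i)`. -/
def vdm (N : ℕ) (z : Fin N → ℝ) : ℝ :=
  ∏ i : Fin N, ∏ j ∈ Finset.Ioi i, (z j - z i)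

/-- A function of matrices which is constant on unitary conjugacy classes. -/
def UnitarilyInvariant {n : ℕ} (Φ : Matrix (Fin n) (Fin n) ℂ → ℂ) : Prop :=
  ∀ U ∈ Matrix.unitaryGroup (Fin n) ℂ, ∀ X, Φ (U * X * star U) = Φ X

theorem UnitarilyInvariant.eq_of_charpoly_eq {n : ℕ} {Φ : Matrix (Fin n) (Fin n) ℂ → ℂ}
    (hΦ : UnitarilyInvariant Φ) {A B : Matrix (Fin n) (Fin n) ℂ} (hA : A.IsHermitian)
    (hB : B.IsHermitian) (h : A.charpoly = B.charpoly) : Φ A = Φ B := by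
  have key : ∀ {M : Matrix (Fin n) (Fin n) ℂ} (hM : M.IsHermitian),
      Φ M = Φ (diagonal (RCLike.ofReal ∘ hM.eigenvalues)) := fun {M} hM => by
    conv_lhs => rw [hM.spectral_theorem, Unitary.conjStarAlgAut_apply]
    exact hΦ _ hM.eigenvectorUnitary.2 _
  rw [key hA, key hB, (hA.eigenvalues_eq_eigenvalues_iff hB).2 h]

theorem isHermitian_diagonal_ofReal {n : ℕ} (d : Fin n → ℝ) :
    (diagonal fun i => (d i : ℂ)).IsHermitian :=
  isHermitian_diagonal_of_self_adjoint _ (by ext i; simp)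

theorem UnitarilyInvariant.diagonal_comp_perm {n : ℕ} {Φ : Matrix (Fin n) (Fin n) ℂ → ℂ}
    (hΦ : UnitarilyInvariant Φ) (d : Fin n → ℝ) (σ : Equiv.Perm (Fin n)) :
    Φ (diagonal fun i => (d (σ i) : ℂ)) = Φ (diagonal fun i => (d i : ℂ)) := by
  refine hΦ.eq_of_charpoly_eq (isHermitian_diagonal_ofReal fun i => d (σ i))
    (isHermitian_diagonal_ofReal d) ?_
  simp only [charpoly_diagonal]
  exact Equiv.prod_comp σ fun i => (Polynomial.X - Polynomial.C (d i : ℂ))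

/-- The matrix obtained from `A` by adding a first row `(c, b)` and a first column `(c, b*)`. -/
def bordered {n : ℕ} (c : ℝ) (b : Fin n → ℂ) (A : Matrix (Fin n) (Fin n) ℂ) :
    Matrix (Fin (n + 1)) (Fin (n + 1)) ℂ :=
  Matrix.of (Fin.cons (Fin.cons (c : ℂ) b) fun i => Fin.cons (star (b i)) (A i))

section bordered

variable {n : ℕ} (c : ℝ) (b : Fin n → ℂ) (A : Matrix (Fin n) (Fin n) ℂ)

@[simp] theorem bordered_zero_zero : bordered c b A 0 0 = c := rfl

@[simp] theorem bordered_zero_succ (j : Fin n) : bordered c b A 0 j.succ = b j := rfl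

@[simp] theorem bordered_succ_zero (i : Fin n) : bordered c b A i.succ 0 = star (b i) := rfl

@[simp] theorem bordered_succ_succ (i j : Fin n) : bordered c b A i.succ j.succ = A i j := rfl

theorem isHermitian_bordered (hA : A.IsHermitian) : (bordered c b A).IsHermitian := by
  ext i j
  refine Fin.cases ?_ (fun i => ?_) i <;> refine Fin.cases ?_ (fun j => ?_) j
  · simp
  · simp
  · simp
  · simpa using hA.apply i j

end bordered

theorem det_arrowhead {n : ℕ} {K : Type*} [Field K] (c : K) (b e D : Fin n → K)
    (hD : ∀ i, D i ≠ 0) :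
    (Matrix.of (Fin.cons (Fin.cons c b) fun i => Fin.cons (e i) (diagonal D i)) :
      Matrix (Fin (n + 1)) (Fin (n + 1)) K).det =
      c * ∏ i, D i - ∑ i, b i * e i * ∏ k ∈ Finset.univ.erase i, D k := by
  set M : Matrix (Fin (n + 1)) (Fin (n + 1)) K :=
    Matrix.of (Fin.cons (Fin.cons c b) fun i => Fin.cons (e i) (diagonal D i))
  set L : Matrix (Fin (n + 1)) (Fin (n + 1)) K :=
    Matrix.of (Fin.cons (Fin.cons 1 0) fun i => Fin.cons (-(e i / D i)) (diagonal 1 i))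
  have hL : L.det = 1 := by
    rw [det_of_isLowerTriangular, Fin.prod_univ_succ]
    · simp [L]
    · intro i j hij
      have hij : i < j := hij
      revert hij
      refine Fin.cases ?_ (fun i => ?_) i <;> refine Fin.cases ?_ (fun j => ?_) j <;> intro hij
      · simp at hij
      · simp [L]
      · simp at hij
      · have : i ≠ j := by rintro rfl; simp at hij
        simp [L, this]
  have hML : (M * L).det = (c - ∑ i, b i * e i / D i) * ∏ i, D i := by
    rw [det_of_isUpperTriangular, Fin.prod_univ_succ]
    · congr 1
      · rw [mul_apply, Fin.sum_univ_succ]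
        simp [M, L, mul_div_assoc, sub_eq_add_neg]
      · refine Finset.prod_congr rfl fun i _ => ?_
        rw [mul_apply, Fin.sum_univ_succ]
        simp [M, L, diagonal_apply]
    · intro i j hij
      have hij : j < i := hij
      revert hij
      refine Fin.cases ?_ (fun i => ?_) i <;> refine Fin.cases ?_ (fun j => ?_) j <;> intro hij
      · simp at hij
      · simp at hij
      · rw [mul_apply, Fin.sum_univ_succ]
        simp [M, L, diagonal_apply, mul_div_cancel₀, hD]
      · have : i ≠ j := by rintro rfl; simp at hij
        rw [mul_apply, Fin.sum_univ_succ]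
        simp [M, L, diagonal_apply, this]
  rw [det_mul, hL, mul_one] at hML
  rw [hML, sub_mul, Finset.sum_mul]
  congr 1
  refine Finset.sum_congr rfl fun i _ => ?_
  rw [← Finset.mul_prod_erase _ _ (Finset.mem_univ i)]
  field_simp [hD i]

open Polynomial in
/-- The characteristic polynomial of a real diagonal matrix with diagonal `a`, bordered by a
diagonal entry `c` and off-diagonal entries of squared moduli `r`. -/
noncomputable def borderPoly {n : ℕ} (a : Fin n → ℝ) (c : ℝ) (r : Fin n → ℝ) : ℝ[X] :=
  (X - C c) * ∏ i, (X - C (a i)) - ∑ i, C (r i) * ∏ k ∈ Finset.univ.erase i, (X - C (a k))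

open Polynomial in
theorem charpoly_bordered_diagonal {n : ℕ} (a : Fin n → ℝ) (c : ℝ) (b : Fin n → ℂ) :
    (bordered c b (diagonal fun i => (a i : ℂ))).charpoly =
      (borderPoly a c fun i => ‖b i‖ ^ 2).map Complex.ofRealHom := by
  refine Polynomial.eq_of_infinite_eval_eq _ _ (Set.Infinite.mono (s := (Set.range
    fun i => (a i : ℂ))ᶜ) ?_ (Set.Finite.infinite_compl (Set.finite_range _)))
  intro x hx
  have hx : ∀ i, x - a i ≠ 0 := fun i h => hx ⟨i, (sub_eq_zero.1 h).symm⟩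
  have := det_arrowhead (x - c) (fun i => -b i) (fun i => -star (b i)) (fun i => x - a i) hx
  simp only [Set.mem_ofPred_eq, eval_charpoly]
  convert this using 1
  · congr 1
    ext i j
    refine Fin.cases ?_ (fun i => ?_) i <;> refine Fin.cases ?_ (fun j => ?_) j
    · simp [scalar_apply]
    · simp [scalar_apply, (Fin.succ_ne_zero _).symm]
    · simp [scalar_apply, Fin.succ_ne_zero]
    · by_cases h : i = j <;> simp [scalar_apply, h]
  · simp [borderPoly, eval_finsetSum, eval_prod, Polynomial.map_sum, Polynomial.map_prod,
      Complex.mul_conj, Complex.normSq_eq_norm_sq]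

open Polynomial in
theorem prod_X_sub_C_eq_borderPoly_iff {n : ℕ} {a : Fin n → ℝ} (ha : Function.Injective a)
    (d : Fin (n + 1) → ℝ) (c : ℝ) (r : Fin n → ℝ) :
    ∏ j, (X - C (d j)) = borderPoly a c r ↔
      c = ∑ j, d j - ∑ i, a i ∧
        ∀ i, ∏ j, (a i - d j) = -(r i * ∏ k ∈ Finset.univ.erase i, (a i - a k)) := by
  have hq : (X - C c) * ∏ i, (X - C (a i)) =
      ∏ j, (X - C ((Fin.cons c a : Fin (n + 1) → ℝ) j)) := by
    simp [Fin.prod_univ_succ]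
  have hcoeff : ∀ f : Fin (n + 1) → ℝ, (∏ j, (X - C (f j))).coeff n = -∑ j, f j := fun f => by
    simpa using prod_X_sub_C_coeff_card_pred Finset.univ f (by simp)
  set s : ℝ[X] := ∑ i, C (r i) * ∏ k ∈ Finset.univ.erase i, (X - C (a k)) with hs
  have hsdeg : s.degree < n := by
    rw [hs]
    refine (degree_sum_le _ _).trans_lt ((Finset.sup_lt_iff (by simp)).2 fun i _ => ?_)
    rw [← smul_eq_C_mul]
    refine (degree_smul_le _ _).trans_lt ?_
    rw [degree_prod]
    simp only [degree_X_sub_C, Finset.sum_const, Finset.card_erase_of_mem (Finset.mem_univ i),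
      Finset.card_univ, Fintype.card_fin, nsmul_eq_mul, mul_one]
    have := i.pos
    exact_mod_cast Nat.sub_lt this one_pos
  have hseval : ∀ i, s.eval (a i) = r i * ∏ k ∈ Finset.univ.erase i, (a i - a k) := fun i => by
    rw [hs, eval_finsetSum, Finset.sum_eq_single i]
    · simp [eval_prod]
    · intro k _ hk
      simp only [eval_mul, eval_C, eval_prod, eval_sub, eval_X]
      rw [Finset.prod_eq_zero (i := i) (by simp [hk.symm]) (sub_self _), mul_zero]
    · simp
  have hqeval : ∀ i, ((X - C c) * ∏ i, (X - C (a i))).eval (a i) = 0 := fun i => by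
    rw [eval_mul, eval_prod, Finset.prod_eq_zero (Finset.mem_univ i) (by simp), mul_zero]
  have hpeval : ∀ t : ℝ, (∏ j, (X - C (d j))).eval t = ∏ j, (t - d j) := fun t => by
    simp [eval_prod]
  unfold borderPoly
  constructor
  · intro h
    refine ⟨?_, fun i => ?_⟩
    · have := congrArg (fun p => coeff p n) h
      simp only [← hs, coeff_sub, hq, hcoeff, Fin.sum_univ_succ (n := n) (Fin.cons c a),
        Fin.cons_zero, Fin.cons_succ, coeff_eq_zero_of_degree_lt hsdeg] at this
      linarith
    · rw [← hpeval, h, eval_sub, hqeval, ← hs, hseval, zero_sub]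
  · rintro ⟨hc, h⟩
    rw [← hs, sub_eq_add_neg, ← sub_eq_iff_eq_add']
    refine eq_of_degrees_lt_of_eval_index_eq Finset.univ ha.injOn ?_ ?_ fun i _ => ?_
    · rw [Finset.card_univ, Fintype.card_fin, degree_lt_iff_coeff_zero]
      intro m hm
      have hmonic : ∀ f : Fin (n + 1) → ℝ, (∏ j, (X - C (f j))).Monic := fun f =>
        monic_prod_X_sub_C f Finset.univ
      have hdeg : ∀ f : Fin (n + 1) → ℝ, (∏ j, (X - C (f j))).natDegree = n + 1 := fun f => by
        simp
      rw [coeff_sub, hq, sub_eq_zero]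
      rcases lt_trichotomy m (n + 1) with h1 | h1 | h1
      · obtain rfl : m = n := by omega
        rw [hcoeff, hcoeff, Fin.sum_univ_succ (Fin.cons c a)]
        simp only [Fin.cons_zero, Fin.cons_succ]
        linarith
      · have h2 := (hmonic d).coeff_natDegree
        have h3 := (hmonic (Fin.cons c a)).coeff_natDegree
        rw [hdeg] at h2 h3
        rw [h1, h2, h3]
      · rw [coeff_eq_zero_of_natDegree_lt (by rw [hdeg]; exact h1),
          coeff_eq_zero_of_natDegree_lt (by rw [hdeg]; exact h1)]
    · simpa using hsdeg
    · rw [eval_sub, hpeval, hqeval, eval_neg, hseval, h, sub_zero]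

theorem neg_one_pow_card_mul_prod_pos {ι : Type*} (s : Finset ι) (f : ι → ℝ)
    (hf : ∀ i ∈ s, f i ≠ 0) : 0 < (-1) ^ (s.filter fun i => f i < 0).card * ∏ i ∈ s, f i := by
  rw [← Finset.prod_const, Finset.prod_filter, ← Finset.prod_mul_distrib]
  refine Finset.prod_pos fun i hi => ?_
  split_ifs with h
  · linarith
  · rw [one_mul]
    exact lt_of_le_of_ne (not_lt.1 h) (hf i hi).symm

/-- The points of `a` separate consecutive points of `d`. -/
def Interlaces {n : ℕ} (a : Fin n → ℝ) (d : Fin (n + 1) → ℝ) : Prop :=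
  ∀ i : Fin n, d i.castSucc < a i ∧ a i < d i.succ

section Interlaces

variable {n : ℕ} {a : Fin n → ℝ} {d : Fin (n + 1) → ℝ}

theorem Interlaces.strictMono_right (h : Interlaces a d) : StrictMono d :=
  Fin.strictMono_iff_lt_succ.2 fun i => (h i).1.trans (h i).2

theorem Interlaces.strictMono_left (h : Interlaces a d) : StrictMono a := fun i j hij =>
  (h i).2.trans_le ((h.strictMono_right.monotone (Fin.succ_le_castSucc_iff.2 hij)).trans (h j).1.le)

theorem prod_erase_sub_ne_zero (ha : Function.Injective a) (i : Fin n) :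
    ∏ k ∈ Finset.univ.erase i, (a i - a k) ≠ 0 :=
  Finset.prod_ne_zero_iff.2 fun _ hk =>
    sub_ne_zero.2 fun h => (Finset.ne_of_mem_erase hk) (ha h).symm

theorem neg_one_pow_mul_prod_erase_pos (ha : StrictMono a) (i : Fin n) :
    0 < (-1) ^ (n - 1 - i : ℕ) * ∏ k ∈ Finset.univ.erase i, (a i - a k) := by
  have h := neg_one_pow_card_mul_prod_pos (Finset.univ.erase i) (fun k => a i - a k)
    fun k hk => sub_ne_zero.2 fun h => (Finset.ne_of_mem_erase hk) (ha.injective h).symm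
  have hcard : ((Finset.univ.erase i).filter fun k => a i - a k < 0) = Finset.Ioi i := by
    ext k
    simp only [Finset.mem_filter, Finset.mem_erase, Finset.mem_univ, and_true, sub_neg,
      ha.lt_iff_lt, Finset.mem_Ioi]
    exact ⟨fun h => h.2, fun h => ⟨h.ne', h⟩⟩
  rwa [hcard, Fin.card_Ioi] at h

theorem Interlaces.prod_mul_prod_neg (h : Interlaces a d) (i : Fin n) :
    (∏ j, (a i - d j)) * ∏ k ∈ Finset.univ.erase i, (a i - a k) < 0 := by
  have hlt : ∀ j, a i < d j ↔ i.castSucc < j := fun j => by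
    refine ⟨fun hj => h.strictMono_right.lt_iff_lt.1 ((h i).1.trans hj), fun hj => ?_⟩
    exact (h i).2.trans_le (h.strictMono_right.monotone (Fin.castSucc_lt_iff_succ_le.1 hj))
  have hne : ∀ j, a i - d j ≠ 0 := fun j hj => by
    rcases le_or_gt j i.castSucc with h1 | h1
    · linarith [(h i).1, h.strictMono_right.monotone h1]
    · linarith [(hlt j).2 h1]
  have h1 := neg_one_pow_card_mul_prod_pos Finset.univ (fun j => a i - d j) fun j _ => hne j
  have hcard : (Finset.univ.filter fun j => a i - d j < 0) = Finset.Ioi i.castSucc := by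
    ext j
    simp [hlt]
  rw [hcard, Fin.card_Ioi] at h1
  have h2 := neg_one_pow_mul_prod_erase_pos h.strictMono_left i
  have hpow : n + 1 - 1 - (i.castSucc : ℕ) = (n - 1 - i) + 1 := by
    have := i.isLt
    simp only [Fin.val_castSucc]
    omega
  rw [hpow, pow_succ] at h1
  have h3 := mul_pos h1 h2
  have h4 : ((-1 : ℝ) ^ (n - 1 - i : ℕ)) * (-1) ^ (n - 1 - i : ℕ) = 1 := by
    rw [← mul_pow]; simp
  nlinarith

theorem Interlaces.of_prod_mul_prod_neg (ha : StrictMono a) (hd : Monotone d)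
    (h : ∀ i, (∏ j, (a i - d j)) * ∏ k ∈ Finset.univ.erase i, (a i - a k) < 0) :
    Interlaces a d := by
  have hne : ∀ i j, a i - d j ≠ 0 := fun i j hij => by
    have := h i
    rw [Finset.prod_eq_zero (Finset.mem_univ j) hij, zero_mul] at this
    exact this.false
  set m : Fin n → ℕ := fun i => (Finset.univ.filter fun j => a i - d j < 0).card
  have hparity : ∀ i, Odd (m i + (n - 1 - i)) := fun i => by
    have h1 := neg_one_pow_card_mul_prod_pos Finset.univ (fun j => a i - d j) fun j _ => hne i j
    have h2 := neg_one_pow_mul_prod_erase_pos ha i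
    have h3 := mul_pos h1 h2
    by_contra hodd
    rw [Nat.not_odd_iff_even] at hodd
    have h4 : ((-1 : ℝ) ^ m i) * (-1) ^ (n - 1 - i : ℕ) = 1 := by
      rw [← pow_add]; exact hodd.neg_one_pow
    have h5 := h i
    rw [mul_mul_mul_comm, h4] at h3
    linarith
  have hanti : ∀ i j, i ≤ j → m j ≤ m i := fun i j hij => by
    refine Finset.card_le_card fun k hk => ?_
    simp only [Finset.mem_filter, Finset.mem_univ, true_and] at hk ⊢
    linarith [ha.monotone hij]
  have hle : ∀ k (hk : k < n), m ⟨k, hk⟩ ≤ n - k := fun k => by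
    induction k with
    | zero =>
      intro hk
      have h1 : m ⟨0, hk⟩ ≤ n + 1 := (Finset.card_le_univ _).trans (by simp)
      have h2 := hparity ⟨0, hk⟩
      rw [Nat.odd_iff] at h2
      simp only at h2
      omega
    | succ k ih =>
      intro hk
      have h1 := ih (by omega)
      have h2 := hparity ⟨k + 1, hk⟩
      have h3 := hanti ⟨k, by omega⟩ ⟨k + 1, hk⟩ (by simp)
      rw [Nat.odd_iff] at h2
      simp only at h2
      omega
  have hge : ∀ l k (hk : k < n), k + l + 1 = n → l + 1 ≤ m ⟨k, hk⟩ := fun l => by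
    induction l with
    | zero =>
      intro k hk hkl
      have h2 := hparity ⟨k, hk⟩
      rw [Nat.odd_iff] at h2
      simp only at h2
      omega
    | succ l ih =>
      intro k hk hkl
      have h1 := ih (k + 1) (by omega) (by omega)
      have h2 := hparity ⟨k, hk⟩
      have h3 := hanti ⟨k, by omega⟩ ⟨k + 1, by omega⟩ (by simp)
      rw [Nat.odd_iff] at h2
      simp only at h2
      omega
  intro i
  have hmi : m i = n - i := le_antisymm (hle i i.isLt)
    (by
      have h1 : n - 1 - i + 1 ≤ m i := hge (n - 1 - i) i i.isLt (by have := i.isLt; omega)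
      have := i.isLt
      omega)
  constructor
  · by_contra! hlt
    have hsub : Finset.Ici i.castSucc ⊆ Finset.univ.filter fun j => a i - d j < 0 := fun j hj => by
      simp only [Finset.mem_filter, Finset.mem_univ, true_and]
      exact lt_of_le_of_ne (by linarith [hd (Finset.mem_Ici.1 hj)]) (hne i j)
    have := Finset.card_le_card hsub
    rw [Fin.card_Ici] at this
    have h2 := i.isLt
    simp only [Fin.val_castSucc] at this
    change _ ≤ m i at this
    omega
  · by_contra! hlt
    have hsub : (Finset.univ.filter fun j => a i - d j < 0) ⊆ Finset.Ioi i.succ := fun j hj => by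
      simp only [Finset.mem_filter, Finset.mem_univ, true_and] at hj
      rw [Finset.mem_Ioi]
      by_contra! hji
      linarith [hd hji]
    have := Finset.card_le_card hsub
    rw [Fin.card_Ioi] at this
    have h2 := i.isLt
    simp only [Fin.val_succ] at this
    change m i ≤ _ at this
    omega

/-- The coordinates `(c, π r)` for which `borderPoly a c r` has roots `d`. -/
noncomputable def borderCoords (a : Fin n → ℝ) (d : Fin (n + 1) → ℝ) : Fin (n + 1) → ℝ :=
  Fin.cons (∑ j, d j - ∑ i, a i) fun i =>
    -(Real.pi * (∏ j, (a i - d j)) / ∏ k ∈ Finset.univ.erase i, (a i - a k))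

open Polynomial in
theorem prod_X_sub_C_eq_borderPoly_iff_borderCoords (ha : Function.Injective a)
    (c : ℝ) (r : Fin n → ℝ) : ∏ j, (X - C (d j)) = borderPoly a c r ↔
      borderCoords a d = Fin.cons c fun i => Real.pi * r i := by
  rw [prod_X_sub_C_eq_borderPoly_iff ha, borderCoords, Fin.cons_inj, eq_comm, funext_iff]
  refine and_congr_right fun _ => forall_congr' fun i => ?_
  have h1 := prod_erase_sub_ne_zero ha i
  have h2 := Real.pi_ne_zero
  rw [neg_eq_iff_eq_neg, div_eq_iff h1]
  constructor
  · intro h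
    rw [h]; ring
  · intro h
    refine mul_left_cancel₀ h2 ?_
    rw [h]; ring

theorem borderCoords_injOn (ha : Function.Injective a) :
    Set.InjOn (borderCoords a) {d | Interlaces a d} := by
  intro d hd d' hd' h
  have key : ∀ d : Fin (n + 1) → ℝ,
      borderCoords a d = Fin.cons (borderCoords a d 0)
        fun i => Real.pi * (borderCoords a d i.succ / Real.pi) := fun d => by
    refine funext fun j => Fin.cases rfl (fun i => ?_) j
    rw [Fin.cons_succ, mul_div_cancel₀ _ Real.pi_ne_zero]
  have h1 := (prod_X_sub_C_eq_borderPoly_iff_borderCoords ha _ _).2 (key d)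
  have h2 := (prod_X_sub_C_eq_borderPoly_iff_borderCoords ha _ _).2 (h.symm.trans (key d))
  have h3 := congrArg Polynomial.roots (h1.trans h2.symm)
  have h4 : ∀ {d d' : Fin (n + 1) → ℝ}, (∏ j, (Polynomial.X - Polynomial.C (d j))).roots =
      (∏ j, (Polynomial.X - Polynomial.C (d' j))).roots → Set.range d ⊆ Set.range d' := by
    rintro d d' h _ ⟨j, rfl⟩
    have : d j ∈ (∏ j, (Polynomial.X - Polynomial.C (d j))).roots := by
      rw [Polynomial.mem_roots (Polynomial.monic_prod_X_sub_C d Finset.univ).ne_zero]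
      simp [Polynomial.IsRoot.def, Polynomial.eval_prod, Finset.prod_eq_zero (Finset.mem_univ j)]
    rw [h, Polynomial.mem_roots (Polynomial.monic_prod_X_sub_C d' Finset.univ).ne_zero,
      Polynomial.IsRoot.def, Polynomial.eval_prod, Finset.prod_eq_zero_iff] at this
    obtain ⟨k, -, hk⟩ := this
    refine ⟨k, ?_⟩
    simp only [Polynomial.eval_sub, Polynomial.eval_X, Polynomial.eval_C] at hk
    linarith
  exact (Interlaces.strictMono_right hd).range_inj (Interlaces.strictMono_right hd') |>.1
    ((h4 h3).antisymm (h4 h3.symm))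

theorem image_borderCoords (ha : StrictMono a) :
    borderCoords a '' {d | Interlaces a d} = {ρ | ∀ i : Fin n, 0 < ρ i.succ} := by
  have hiff : ∀ d i, 0 < borderCoords a d (Fin.succ i) ↔
      (∏ j, (a i - d j)) * ∏ k ∈ Finset.univ.erase i, (a i - a k) < 0 := fun d i => by
    have h1 := prod_erase_sub_ne_zero ha.injective i
    rw [borderCoords, Fin.cons_succ, neg_pos, mul_div_assoc, mul_neg_iff, mul_neg_iff, div_neg_iff]
    simp [Real.pi_pos, Real.pi_pos.not_gt]
  ext ρ
  constructor
  · rintro ⟨d, hd, rfl⟩ i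
    exact (hiff d i).2 (Interlaces.prod_mul_prod_neg hd i)
  · intro hρ
    have hρ : ∀ i : Fin n, 0 < ρ i.succ := hρ
    set b : Fin n → ℂ := fun i => (√(ρ i.succ / Real.pi) : ℝ) with hb
    have hbn : (fun i => ‖b i‖ ^ 2) = fun i => ρ i.succ / Real.pi := funext fun i => by
      rw [hb, Complex.norm_real, Real.norm_eq_abs, sq_abs, Real.sq_sqrt]
      exact (div_pos (hρ i) Real.pi_pos).le
    have hH := isHermitian_bordered (ρ 0) b _ (isHermitian_diagonal_ofReal a)
    have hchar := hH.charpoly_eq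
    rw [charpoly_bordered_diagonal, hbn] at hchar
    set d := hH.eigenvalues ∘ Tuple.sort hH.eigenvalues with hd
    have hprod : ∏ j, (Polynomial.X - Polynomial.C (d j)) =
        borderPoly a (ρ 0) fun i => ρ i.succ / Real.pi := by
      apply Polynomial.map_injective Complex.ofRealHom Complex.ofReal_injective
      rw [hchar, Polynomial.map_prod]
      simp only [Polynomial.map_sub, Polynomial.map_X, Polynomial.map_C, hd, Function.comp_apply]
      exact Equiv.prod_comp (Tuple.sort hH.eigenvalues) fun j =>
        Polynomial.X - Polynomial.C (hH.eigenvalues j : ℂ)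
    have hcoords : borderCoords a d = ρ := by
      rw [(prod_X_sub_C_eq_borderPoly_iff_borderCoords ha.injective _ _).1 hprod]
      refine funext fun j => Fin.cases rfl (fun i => ?_) j
      rw [Fin.cons_succ, mul_div_cancel₀ _ Real.pi_ne_zero]
    refine ⟨d, Interlaces.of_prod_mul_prod_neg ha (Tuple.monotone_sort _) fun i => ?_, hcoords⟩
    rw [← hiff, hcoords]
    exact hρ i

theorem UnitarilyInvariant.bordered_diagonal {Φ : Matrix (Fin (n + 1)) (Fin (n + 1)) ℂ → ℂ}
    (hΦ : UnitarilyInvariant Φ) (ha : Function.Injective a) {c : ℝ} {b : Fin n → ℂ}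
    (h : borderCoords a d = Fin.cons c fun i => Real.pi * ‖b i‖ ^ 2) :
    Φ (bordered c b (diagonal fun i => (a i : ℂ))) = Φ (diagonal fun i => (d i : ℂ)) := by
  refine hΦ.eq_of_charpoly_eq (isHermitian_bordered _ _ _ (isHermitian_diagonal_ofReal a))
    (isHermitian_diagonal_ofReal d) ?_
  rw [charpoly_bordered_diagonal, ← (prod_X_sub_C_eq_borderPoly_iff_borderCoords ha _ _).2 h,
    charpoly_diagonal, Polynomial.map_prod]
  simp

end Interlaces

theorem vdm_eq_det_vandermonde {n : ℕ} (z : Fin n → ℝ) : vdm n z = (vandermonde z).det :=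
  (det_vandermonde z).symm

theorem vdm_pos {n : ℕ} {z : Fin n → ℝ} (hz : StrictMono z) : 0 < vdm n z :=
  Finset.prod_pos fun _ _ => Finset.prod_pos fun _ hj => sub_pos.2 (hz (Finset.mem_Ioi.1 hj))

theorem vdm_ne_zero {n : ℕ} {z : Fin n → ℝ} (hz : Function.Injective z) : vdm n z ≠ 0 := by
  rw [vdm_eq_det_vandermonde]
  exact det_vandermonde_ne_zero_iff.2 hz

theorem vdm_succ {n : ℕ} (z : Fin (n + 1) → ℝ) :
    vdm (n + 1) z = (∏ i : Fin n, (z i.succ - z 0)) * vdm n fun i => z i.succ := by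
  simp [vdm, Fin.prod_univ_succ, Fin.prod_Ioi_succ]

theorem vdm_comp_perm {n : ℕ} (z : Fin n → ℝ) (σ : Equiv.Perm (Fin n)) :
    vdm n (fun i => z (σ i)) = (Equiv.Perm.sign σ : ℤ) * vdm n z := by
  rw [vdm_eq_det_vandermonde, vdm_eq_det_vandermonde, ← det_permute]
  rfl

theorem continuous_vdm (n : ℕ) : Continuous (vdm n) := by
  unfold vdm
  fun_prop

theorem prod_prod_erase_abs_sub {n : ℕ} (z : Fin n → ℝ) :
    ∏ i, ∏ k ∈ Finset.univ.erase i, |z i - z k| = vdm n z ^ 2 := by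
  have hsplit : ∀ i : Fin n, ∏ k ∈ Finset.univ.erase i, |z i - z k| =
      (∏ k ∈ Finset.Ioi i, |z k - z i|) * ∏ k ∈ Finset.Iio i, |z i - z k| := fun i => by
    have hu : Finset.univ.erase i = Finset.Ioi i ∪ Finset.Iio i := by
      ext k
      simp [lt_or_lt_iff_ne, eq_comm]
    rw [hu, Finset.prod_union (Finset.disjoint_left.2 fun k h1 h2 =>
      (Finset.mem_Ioi.1 h1).not_gt (Finset.mem_Iio.1 h2))]
    simp only [abs_sub_comm (z i)]
  rw [Finset.prod_congr rfl fun i _ => hsplit i, Finset.prod_mul_distrib,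
    Finset.prod_comm' (s := Finset.univ) (t := fun i => Finset.Iio i) (t' := Finset.univ)
      (s' := fun k => Finset.Ioi k) (by simp), ← sq, ← sq_abs (vdm n z), vdm, Finset.abs_prod]
  simp only [Finset.abs_prod]

open Polynomial in
theorem abs_det_prod_erase_sub {n : ℕ} (a : Fin n → ℝ) {d : Fin (n + 1) → ℝ}
    (hd : Function.Injective d) :
    |(Matrix.of (Fin.cons (fun _ => 1) fun i j => ∏ l ∈ Finset.univ.erase j, (a i - d l)) :
      Matrix (Fin (n + 1)) (Fin (n + 1)) ℝ).det| = |vdm n a| * |vdm (n + 1) d| := by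
  set p : Fin (n + 1) → ℝ[X] := fun j => ∏ l ∈ Finset.univ.erase j, (X - C (d l)) with hp
  have hdeg : ∀ j, (p j).natDegree = n := fun j => by
    simp [hp, natDegree_prod_of_monic _ _ fun l _ => monic_X_sub_C (d l)]
  have hmonic : ∀ j, (p j).Monic := fun j => monic_prod_of_monic _ _ fun l _ => monic_X_sub_C (d l)
  have heval : ∀ j x, (p j).eval x = ∑ k : Fin (n + 1), x ^ (k : ℕ) * (p j).coeff k := fun j x => by
    rw [eval_eq_sum_range, hdeg, Finset.sum_range]
    simp only [mul_comm]
  set B : Matrix (Fin (n + 1)) (Fin (n + 1)) ℝ := Matrix.of fun k j => (p j).coeff k with hB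
  set A := projVandermonde (Fin.cons 1 a) (Fin.cons 0 fun _ => (1 : ℝ)) with hA
  have hdetA : |A.det| = |vdm n a| := by
    rw [hA, det_projVandermonde]
    simp [vdm, Fin.prod_univ_succ, Fin.prod_Ioi_succ, abs_mul]
  have hAB : (Matrix.of (Fin.cons (fun _ => 1) fun i j =>
      ∏ l ∈ Finset.univ.erase j, (a i - d l)) : Matrix (Fin (n + 1)) (Fin (n + 1)) ℝ) = A * B := by
    ext i j
    rw [mul_apply]
    refine Fin.cases ?_ (fun i => ?_) i
    · rw [Finset.sum_eq_single (Fin.last n)]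
      · have := (hmonic j).coeff_natDegree
        rw [hdeg] at this
        simp [hA, hB, projVandermonde_apply, this]
      · intro k _ hk
        have : n - (k : ℕ) ≠ 0 := by
          have := Fin.val_lt_last hk
          omega
        simp [hA, projVandermonde_apply, this]
      · simp
    · have := heval j (a i)
      simp only [hp, eval_prod, eval_sub, eval_X, eval_C] at this
      simp [hA, hB, projVandermonde_apply, this, hp]
  have hVB : vandermonde d * B = diagonal fun j => ∏ l ∈ Finset.univ.erase j, (d j - d l) := by
    ext i j
    have := heval j (d i)
    simp only [hp, eval_prod, eval_sub, eval_X, eval_C] at this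
    rw [mul_apply]
    simp only [vandermonde_apply, hB, of_apply, hp, ← this, diagonal_apply]
    split_ifs with h
    · rw [h]
    · exact Finset.prod_eq_zero (i := i) (by simp [h]) (sub_self _)
  have hdetVB := congrArg (fun M => |M.det|) hVB
  simp only [det_mul, det_diagonal, abs_mul, ← vdm_eq_det_vandermonde, Finset.abs_prod,
    prod_prod_erase_abs_sub] at hdetVB
  have hne := abs_ne_zero.2 (vdm_ne_zero hd)
  rw [hAB, det_mul, abs_mul, hdetA]
  congr 1
  refine mul_left_cancel₀ hne ?_
  rw [hdetVB, ← sq_abs, sq]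

section

variable {n : ℕ}

/-- The Jacobian matrix of `borderCoords a` at `d`. -/
noncomputable def borderJacobian (a : Fin n → ℝ) (d : Fin (n + 1) → ℝ) :
    Matrix (Fin (n + 1)) (Fin (n + 1)) ℝ :=
  Matrix.of (Fin.cons (fun _ => 1) fun i j =>
    Real.pi / (∏ k ∈ Finset.univ.erase i, (a i - a k)) * ∏ l ∈ Finset.univ.erase j, (a i - d l))

theorem hasFDerivAt_borderCoords (a : Fin n → ℝ) (d : Fin (n + 1) → ℝ) :
    HasFDerivAt (borderCoords a) (toLin' (borderJacobian a d)).toContinuousLinearMap d := by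
  refine hasFDerivAt_pi'' fun i => ?_
  refine Fin.cases ?_ (fun i => ?_) i
  · have h : HasFDerivAt (fun d : Fin (n + 1) → ℝ => ∑ j, d j - ∑ i, a i)
        (∑ j, ContinuousLinearMap.proj (R := ℝ) (φ := fun _ => ℝ) j) d :=
      (HasFDerivAt.fun_sum (A := fun j (d : Fin (n + 1) → ℝ) => d j) fun j _ =>
        hasFDerivAt_apply j d).sub_const _
    refine h.congr_fderiv ?_
    ext v
    simp [borderJacobian, mulVec, dotProduct]
  · have h1 := HasFDerivAt.finsetProd (u := Finset.univ) (x := d) (fun j _ =>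
      ((hasFDerivAt_apply (𝕜 := ℝ) (F' := fun _ : Fin (n + 1) => ℝ) j d).const_sub (a i)))
    have h2 := (h1.const_mul (-Real.pi / ∏ k ∈ Finset.univ.erase i, (a i - a k)))
    refine (h2.congr_fderiv ?_).congr_of_eventuallyEq (Filter.Eventually.of_forall fun x => ?_)
    · ext v
      simp [borderJacobian, mulVec, dotProduct, Finset.mul_sum]
      rw [← Finset.sum_neg_distrib]
      exact Finset.sum_congr rfl fun j _ => by ring
    · simp only [borderCoords, Fin.cons_succ]
      ring

theorem abs_det_borderJacobian {a : Fin n → ℝ} {d : Fin (n + 1) → ℝ} (ha : StrictMono a)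
    (hd : StrictMono d) :
    |(borderJacobian a d).det| = Real.pi ^ n * vdm (n + 1) d / vdm n a := by
  have h : borderJacobian a d = diagonal (Fin.cons 1 fun i =>
      Real.pi / (∏ k ∈ Finset.univ.erase i, (a i - a k))) *
      (Matrix.of (Fin.cons (fun _ => 1) fun i j => ∏ l ∈ Finset.univ.erase j, (a i - d l)) :
        Matrix (Fin (n + 1)) (Fin (n + 1)) ℝ) := by
    ext i j
    rw [diagonal_mul]
    refine Fin.cases ?_ (fun i => ?_) i <;> simp [borderJacobian]
  have hpos := vdm_pos ha
  rw [h, det_mul, abs_mul, abs_det_prod_erase_sub a hd.injective, det_diagonal, Fin.prod_univ_succ,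
    abs_of_pos hpos, abs_of_pos (vdm_pos hd)]
  simp only [Fin.cons_zero, Fin.cons_succ, one_mul, Finset.abs_prod, abs_div,
    Finset.prod_div_distrib, prod_prod_erase_abs_sub, abs_pow, Finset.prod_const,
    Finset.card_univ, Fintype.card_fin, abs_of_pos Real.pi_pos]
  field_simp

end

/-! ### Measure-preserving maps -/

theorem measurePreserving_pi_mul_norm_sq :
    MeasurePreserving (fun z : ℂ => Real.pi * ‖z‖ ^ 2) volume (volume.restrict (Set.Ioi 0)) := by
  have hmeas : Measurable fun z : ℂ => Real.pi * ‖z‖ ^ 2 := by fun_prop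
  refine ⟨hmeas, ?_⟩
  have key : ∀ t : ℝ, volume ((fun z : ℂ => Real.pi * ‖z‖ ^ 2) ⁻¹' Set.Iio t) =
      ENNReal.ofReal t := fun t => by
    rcases le_or_gt t 0 with ht | ht
    · have : (fun z : ℂ => Real.pi * ‖z‖ ^ 2) ⁻¹' Set.Iio t = ∅ := by
        ext z
        simp only [Set.mem_preimage, Set.mem_Iio, Set.mem_empty_iff_false, iff_false, not_lt]
        exact ht.trans (by positivity)
      rw [this, measure_empty, ENNReal.ofReal_of_nonpos ht]
    · have : (fun z : ℂ => Real.pi * ‖z‖ ^ 2) ⁻¹' Set.Iio t =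
          Metric.ball 0 √(t / Real.pi) := by
        ext z
        rw [Set.mem_preimage, Set.mem_Iio, mem_ball_zero_iff, Real.lt_sqrt (norm_nonneg z),
          lt_div_iff₀' Real.pi_pos]
      rw [this, Complex.volume_ball, ← ENNReal.ofReal_pow (Real.sqrt_nonneg _),
        Real.sq_sqrt (by positivity), ← ENNReal.ofReal_coe_nnreal,
        ← ENNReal.ofReal_mul (by positivity), NNReal.coe_real_pi, div_mul_cancel₀ _ Real.pi_ne_zero]
  refine Measure.ext_of_generateFrom_of_iUnion (Set.range Set.Iio) (fun k : ℕ => Set.Iio (k : ℝ))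
    (by rw [← borel_eq_generateFrom_Iio]; exact BorelSpace.measurable_eq) isPiSystem_Iio ?_
    (fun k => ⟨k, rfl⟩) (fun k => ?_) ?_
  · refine Set.eq_univ_of_forall fun x => ?_
    obtain ⟨k, hk⟩ := exists_nat_gt x
    exact Set.mem_iUnion.2 ⟨k, hk⟩
  · rw [Measure.map_apply hmeas measurableSet_Iio, key]
    exact ENNReal.ofReal_ne_top
  · rintro _ ⟨t, rfl⟩
    rw [Measure.map_apply hmeas measurableSet_Iio, key, Measure.restrict_apply measurableSet_Iio,
      Set.inter_comm, Set.Ioi_inter_Iio, Real.volume_Ioo, sub_zero]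

theorem measurePreserving_cons_pi_mul_norm_sq (n : ℕ) :
    MeasurePreserving
      (fun x : ℝ × (Fin n → ℂ) =>
        (Fin.cons x.1 fun i => Real.pi * ‖x.2 i‖ ^ 2 : Fin (n + 1) → ℝ))
      volume (volume.restrict {ρ | ∀ i : Fin n, 0 < ρ i.succ}) := by
  have h1 := (MeasurePreserving.id (volume : Measure ℝ)).prod
    (measurePreserving_pi (fun _ : Fin n => (volume : Measure ℂ)) _
      fun _ => measurePreserving_pi_mul_norm_sq)
  have h2 := (((volume_preserving_piFinSuccAbove (fun _ : Fin (n + 1) => ℝ) 0).symm _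
    ).restrict_preimage_emb (MeasurableEquiv.measurableEmbedding _)
      {ρ | ∀ i : Fin n, 0 < ρ i.succ})
  have hset : (MeasurableEquiv.piFinSuccAbove (fun _ : Fin (n + 1) => ℝ) 0).symm ⁻¹'
      {ρ | ∀ i : Fin n, 0 < ρ i.succ} = Set.univ ×ˢ Set.univ.pi fun _ => Set.Ioi 0 := by
    ext x
    simp [Fin.consEquiv]
  rw [Measure.volume_eq_prod, hset, ← Measure.prod_restrict, Measure.restrict_univ, volume_pi,
    Measure.restrict_pi_pi] at h2
  have hfun : (fun x : ℝ × (Fin n → ℂ) =>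
      (Fin.cons x.1 fun i => Real.pi * ‖x.2 i‖ ^ 2 : Fin (n + 1) → ℝ)) =
      (MeasurableEquiv.piFinSuccAbove (fun _ : Fin (n + 1) => ℝ) 0).symm ∘
        Prod.map id fun a i => Real.pi * ‖a i‖ ^ 2 := by
    ext x i
    refine Fin.cases ?_ (fun i => ?_) i <;> simp [Fin.consEquiv]
  rw [hfun]
  exact h2.comp h1

theorem measurePreserving_vecMul_of_mem_unitaryGroup {n : ℕ} {U : Matrix (Fin n) (Fin n) ℂ}
    (hU : U ∈ unitaryGroup (Fin n) ℂ) :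
    MeasurePreserving (fun b : Fin n → ℂ => b ᵥ* U) volume volume := by
  have hn : ‖U.det‖ = 1 := CStarRing.norm_of_mem_unitary (det_of_mem_unitary hU)
  have hdet : LinearMap.det ((toLin' Uᵀ).restrictScalars ℝ) = 1 := by
    rw [LinearMap.det_restrictScalars, LinearMap.det_toLin', det_transpose,
      Algebra.norm_complex_apply, Complex.normSq_eq_norm_sq, hn, one_pow]
  have hfun : (fun b : Fin n → ℂ => b ᵥ* U) = (toLin' Uᵀ).restrictScalars ℝ := by
    ext b
    simp [mulVec_transpose]
  rw [hfun]
  refine ⟨(LinearMap.continuous_of_finiteDimensional _).measurable, ?_⟩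
  rw [Measure.map_linearMap_addHaar_eq_smul_addHaar _ (by rw [hdet]; exact one_ne_zero), hdet]
  simp

/-- The measurable equivalence exchanging the two middle factors of a product of two products. -/
def MeasurableEquiv.prodProdProdComm' (A B C D : Type*) [MeasurableSpace A] [MeasurableSpace B]
    [MeasurableSpace C] [MeasurableSpace D] : (A × B) × (C × D) ≃ᵐ (C × A) × (B × D) where
  toFun x := ((x.2.1, x.1.1), (x.1.2, x.2.2))
  invFun x := ((x.1.2, x.2.1), (x.1.1, x.2.2))
  left_inv _ := rfl
  right_inv _ := rfl
  measurable_toFun := by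
    change Measurable fun x : (A × B) × (C × D) => ((x.2.1, x.1.1), (x.1.2, x.2.2))
    fun_prop
  measurable_invFun := by
    change Measurable fun x : (C × A) × (B × D) => ((x.1.2, x.2.1), (x.1.1, x.2.2))
    fun_prop

theorem volume_preserving_prodProdProdComm' (A B C D : Type*) [MeasureSpace A] [MeasureSpace B]
    [MeasureSpace C] [MeasureSpace D] [SigmaFinite (volume : Measure A)]
    [SigmaFinite (volume : Measure B)] [SigmaFinite (volume : Measure C)]
    [SigmaFinite (volume : Measure D)] :
    MeasurePreserving (MeasurableEquiv.prodProdProdComm' A B C D) := by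
  have h1 := volume_preserving_prodAssoc (α₁ := A) (β₁ := B) (γ₁ := C × D)
  have h2 : MeasurePreserving (fun x : B × (C × D) => (x.2.1, (x.1, x.2.2))) :=
    (volume_preserving_prodAssoc (α₁ := C) (β₁ := B) (γ₁ := D)).comp
      (((Measure.measurePreserving_swap (μ := (volume : Measure B)) (ν := (volume : Measure C))).prod
        (MeasurePreserving.id (volume : Measure D))).comp
          ((volume_preserving_prodAssoc (α₁ := B) (β₁ := C) (γ₁ := D)).symm _))
  have h3 := (MeasurePreserving.id (volume : Measure A)).prod h2
  have h4 := (volume_preserving_prodAssoc (α₁ := A) (β₁ := C) (γ₁ := B × D)).symm _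
  have h5 := (Measure.measurePreserving_swap (μ := (volume : Measure A))
    (ν := (volume : Measure C))).prod (MeasurePreserving.id (volume : Measure (B × D)))
  exact h5.comp (h4.comp (h3.comp h1))

/-- Pairs `i < j` in `Fin (n + 1)` are either pairs in `Fin n` or pairs with `i = 0`. -/
noncomputable def pairEquiv (n : ℕ) : { p : Fin n × Fin n // p.1 < p.2 } ⊕ Fin n ≃
    { p : Fin (n + 1) × Fin (n + 1) // p.1 < p.2 } :=
  Equiv.ofBijective (Sum.elim (fun p => ⟨(p.1.1.succ, p.1.2.succ), Fin.succ_lt_succ_iff.2 p.2⟩)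
    fun j => ⟨(0, j.succ), j.succ_pos⟩) <| by
    constructor
    · rintro (⟨⟨i, j⟩, h⟩ | j) (⟨⟨i', j'⟩, h'⟩ | j') <;>
        simp [Fin.succ_ne_zero, (Fin.succ_ne_zero _).symm]
    · rintro ⟨⟨i, j⟩, h⟩
      obtain ⟨j, rfl⟩ := Fin.exists_succ_eq.2 (Fin.ne_zero_of_lt h)
      induction i using Fin.cases with
      | zero => exact ⟨.inr j, rfl⟩
      | succ i => exact ⟨.inl ⟨(i, j), Fin.succ_lt_succ_iff.1 h⟩, rfl⟩

/-- The coordinates of a Hermitian matrix obtained by bordering. -/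
noncomputable def borderEquiv (n : ℕ) :
    ((Fin n → ℝ) × ({ p : Fin n × Fin n // p.1 < p.2 } → ℝ × ℝ)) × (ℝ × (Fin n → ℂ)) ≃ᵐ
      (Fin (n + 1) → ℝ) × ({ p : Fin (n + 1) × Fin (n + 1) // p.1 < p.2 } → ℝ × ℝ) :=
  (MeasurableEquiv.prodProdProdComm' _ _ _ _).trans
    (MeasurableEquiv.prodCongr (MeasurableEquiv.piFinSuccAbove (fun _ => ℝ) 0).symm
      ((MeasurableEquiv.prodCongr (MeasurableEquiv.refl _)
          (MeasurableEquiv.piCongrRight fun _ => Complex.measurableEquivRealProd)).trans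
        ((MeasurableEquiv.sumPiEquivProdPi fun _ => ℝ × ℝ).symm.trans
          (MeasurableEquiv.piCongrLeft (fun _ => ℝ × ℝ) (pairEquiv n)))))

theorem volume_preserving_borderEquiv (n : ℕ) : MeasurePreserving (borderEquiv n) := by
  have h1 := (volume_preserving_piFinSuccAbove (fun _ : Fin (n + 1) => ℝ) 0).symm _
  have h2 := (MeasurePreserving.id
    (volume : Measure ({ p : Fin n × Fin n // p.1 < p.2 } → ℝ × ℝ))).prod
      (volume_preserving_pi fun _ : Fin n => Complex.volume_preserving_equiv_real_prod)
  have h3 := volume_measurePreserving_sumPiEquivProdPi_symm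
    (fun _ : { p : Fin n × Fin n // p.1 < p.2 } ⊕ Fin n => ℝ × ℝ)
  have h4 := volume_measurePreserving_piCongrLeft
    (fun _ : { p : Fin (n + 1) × Fin (n + 1) // p.1 < p.2 } => ℝ × ℝ) (pairEquiv n)
  exact (h1.prod (h4.comp (h3.comp h2))).comp (volume_preserving_prodProdProdComm' _ _ _ _)

theorem hermMat_borderEquiv {n : ℕ}
    (x : ((Fin n → ℝ) × ({ p : Fin n × Fin n // p.1 < p.2 } → ℝ × ℝ)) × (ℝ × (Fin n → ℂ))) :
    hermMat (n + 1) (borderEquiv n x) = bordered x.2.1 x.2.2 (hermMat n x.1) := by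
  have hp : ∀ s, (borderEquiv n x).2 (pairEquiv n s) =
      Sum.elim x.1.2 (fun j => ((x.2.2 j).re, (x.2.2 j).im)) s := fun s => by
    rcases s with p | j
    · exact Equiv.piCongrLeft_apply_apply (fun _ => ℝ × ℝ) (pairEquiv n) _ _
    · exact Equiv.piCongrLeft_apply_apply (fun _ => ℝ × ℝ) (pairEquiv n) _ _
  have h0 : ∀ j, (borderEquiv n x).2 ⟨(0, Fin.succ j), j.succ_pos⟩ =
      ((x.2.2 j).re, (x.2.2 j).im) := fun j => hp (.inr j)
  have hs : ∀ (i j : Fin n) (h : i < j), (borderEquiv n x).2 ⟨(i.succ, j.succ),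
      Fin.succ_lt_succ_iff.2 h⟩ = x.1.2 ⟨(i, j), h⟩ := fun i j h => hp (.inl ⟨(i, j), h⟩)
  have hd : (borderEquiv n x).1 = Fin.cons x.2.1 x.1.1 := by
    change (MeasurableEquiv.piFinSuccAbove (fun _ : Fin (n + 1) => ℝ) 0).symm _ = _
    ext i
    refine Fin.cases ?_ (fun i => ?_) i <;>
      simp [Fin.consEquiv]
  ext i j
  refine Fin.cases ?_ (fun i => ?_) i <;> refine Fin.cases ?_ (fun j => ?_) j
  · simp [hermMat, hd]
  · simp [hermMat, h0]
  · simp [hermMat, h0, Complex.ext_iff]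
  · rcases lt_trichotomy i j with h | h | h
    · simp [hermMat, h, hs]
    · simp [hermMat, h, hd]
    · simp [hermMat, h, h.not_gt, hs]

/-! ### The exponential determinant -/

/-- The matrix with entries `e^{-i d_j y_k}`. -/
noncomputable def expMatrix {n : ℕ} (d y : Fin n → ℝ) : Matrix (Fin n) (Fin n) ℂ :=
  of fun j k => Complex.exp (-Complex.I * (d j * y k))

theorem continuous_expMatrix {n : ℕ} (y : Fin n → ℝ) : Continuous fun d => expMatrix d y := by
  refine continuous_matrix fun j k => ?_
  simp only [expMatrix, of_apply]
  fun_prop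

theorem norm_det_expMatrix_le {n : ℕ} (d y : Fin n → ℝ) : ‖(expMatrix d y).det‖ ≤ n.factorial := by
  rw [det_apply]
  refine (norm_sum_le _ _).trans ?_
  refine (Finset.sum_le_card_nsmul _ _ 1 fun σ _ => ?_).trans ?_
  · have h : ∀ i, ‖expMatrix d y (σ i) i‖ = 1 := fun i => by
      rw [expMatrix, of_apply, Complex.norm_exp]
      simp
    rcases Int.units_eq_one_or (Equiv.Perm.sign σ) with hs | hs <;> simp [hs, norm_prod, h]
  · simp [Fintype.card_perm]

theorem expMatrix_sub_const {n : ℕ} (d y : Fin n → ℝ) (c : ℝ) :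
    (expMatrix d fun k => y k - c).det =
      Complex.exp (Complex.I * (c * ∑ j, (d j : ℂ))) * (expMatrix d y).det := by
  rw [Finset.mul_sum, Finset.mul_sum, Complex.exp_sum, ← det_mul_column]
  congr 1
  ext j k
  simp only [expMatrix, of_apply, ← Complex.exp_add]
  congr 1
  push_cast
  ring

theorem det_expMatrix_cons_zero {n : ℕ} (d : Fin (n + 1) → ℝ) (z : Fin n → ℝ) :
    (expMatrix d (Fin.cons 0 z)).det = det (of fun j k : Fin n =>
      Complex.exp (-Complex.I * (d j.succ * z k)) -
        Complex.exp (-Complex.I * (d j.castSucc * z k))) := by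
  set M := expMatrix d (Fin.cons 0 z) with hM
  rw [det_eq_of_forall_row_eq_smul_add_pred (A := M)
    (B := of (Fin.cons (M 0) fun i j => M i.succ j - M i.castSucc j)) (fun _ => 1)
    (fun j => by simp) (fun i j => by simp), det_succ_column_zero, Fin.sum_univ_succ]
  simp [hM, expMatrix, submatrix]

theorem integral_det_expMatrix {n : ℕ} {d : Fin (n + 1) → ℝ} (hd : StrictMono d)
    {z : Fin n → ℝ} (hz : ∀ k, z k ≠ 0) :
    ∫ a in Set.univ.pi fun i : Fin n => Set.Ioo (d i.castSucc) (d i.succ), (expMatrix a z).det =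
      (∏ k, (-Complex.I * z k))⁻¹ * (expMatrix d (Fin.cons 0 z)).det := by
  have hc : ∀ k, -Complex.I * (z k : ℂ) ≠ 0 := fun k => by simp [hz k]
  have h_int : ∀ i k : Fin n, ∫ t in Set.Ioo (d i.castSucc) (d i.succ),
      Complex.exp (-Complex.I * (t * z k)) = (-Complex.I * z k)⁻¹ *
        (Complex.exp (-Complex.I * (d i.succ * z k)) -
          Complex.exp (-Complex.I * (d i.castSucc * z k))) := fun i k => by
    rw [← integral_Ioc_eq_integral_Ioo, ← intervalIntegral.integral_of_le
      (hd.monotone (Fin.castSucc_le_succ i))]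
    have := integral_exp_mul_complex (a := d i.castSucc) (b := d i.succ) (hc k)
    rw [div_eq_inv_mul] at this
    convert this using 4 <;> ring_nf
  have h_int' : ∀ i k : Fin n, IntegrableOn (fun t : ℝ => Complex.exp (-Complex.I * (t * z k)))
      (Set.Ioo (d i.castSucc) (d i.succ)) := fun i k =>
    (Continuous.integrableOn_Icc (by fun_prop)).mono_set Set.Ioo_subset_Icc_self
  rw [det_expMatrix_cons_zero, ← Finset.prod_inv_distrib, ← det_mul_row, volume_pi,
    Measure.restrict_pi_pi, ← det_transpose, det_apply]
  simp_rw [← det_transpose (expMatrix _ z), det_apply, transpose_apply, of_apply, expMatrix,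
    of_apply, ← h_int]
  rw [integral_finsetSum]
  · refine Finset.sum_congr rfl fun σ _ => ?_
    simp only [Units.smul_def, zsmul_eq_mul]
    rw [integral_const_mul, integral_fintype_prod_eq_prod
      (fun i (t : ℝ) => Complex.exp (-Complex.I * (t * z (σ i))))]
  · intro σ _
    simp only [Units.smul_def, zsmul_eq_mul]
    exact (Integrable.fintype_prod (f := fun i (t : ℝ) =>
      Complex.exp (-Complex.I * (t * z (σ i)))) fun i => h_int' i (σ i)).const_mul _

theorem setOf_interlaces {n : ℕ} (d : Fin (n + 1) → ℝ) :
    {a | Interlaces a d} = Set.univ.pi fun i : Fin n => Set.Ioo (d i.castSucc) (d i.succ) := by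
  ext a
  simp [Interlaces]

theorem integral_exp_mul_det_expMatrix {n : ℕ} {d y : Fin (n + 1) → ℝ} (hd : StrictMono d)
    (hy : Function.Injective y) :
    ∫ a in {a : Fin n → ℝ | Interlaces a d}, Complex.exp (Complex.I * (y 0 * ∑ i, (a i : ℂ))) *
        (expMatrix a fun k => y k.succ).det =
      (∏ k : Fin n, (-Complex.I * (y k.succ - y 0)))⁻¹ *
        (Complex.exp (Complex.I * (y 0 * ∑ i, (d i : ℂ))) * (expMatrix d y).det) := by
  have h := integral_det_expMatrix hd (z := fun k => y k.succ - y 0)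
    fun k => sub_ne_zero.2 (hy.ne (Fin.succ_ne_zero k))
  have hcons : (Fin.cons 0 fun k : Fin n => y k.succ - y 0) = fun k => y k - y 0 := by
    ext k
    refine Fin.cases ?_ (fun k => ?_) k <;> simp
  rw [hcons] at h
  simp_rw [expMatrix_sub_const] at h
  rw [setOf_interlaces, h]
  push_cast
  rfl

/-! ### Integration over ordered tuples -/

theorem measurableSet_strictMono (n : ℕ) : MeasurableSet {d : Fin n → ℝ | StrictMono d} := by
  have : {d : Fin n → ℝ | StrictMono d} =
      ⋂ (i : Fin n) (j : Fin n) (_ : i < j), {d | d i < d j} := by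
    ext d
    simp [StrictMono]
  rw [this]
  exact .iInter fun i => .iInter fun j => .iInter fun _ =>
    measurableSet_lt (measurable_pi_apply i) (measurable_pi_apply j)

theorem ae_injective (n : ℕ) : ∀ᵐ d : Fin n → ℝ, Function.Injective d := by
  have h : ∀ i j : Fin n, i ≠ j → ∀ᵐ d : Fin n → ℝ, d i ≠ d j := fun i j hij => by
    have := Measure.addHaar_submodule (volume : Measure (Fin n → ℝ))
      (LinearMap.ker (LinearMap.proj (R := ℝ) (φ := fun _ : Fin n => ℝ) i - LinearMap.proj j))
      fun htop => by
        have : Pi.single i (1 : ℝ) ∈ LinearMap.ker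
          (LinearMap.proj (R := ℝ) (φ := fun _ : Fin n => ℝ) i - LinearMap.proj j) := by
          rw [htop]
          trivial
        simp [hij.symm] at this
    rw [ae_iff]
    convert this using 2
    ext d
    simp [sub_eq_zero]
  have h' : ∀ᵐ d : Fin n → ℝ, ∀ i j : Fin n, i ≠ j → d i ≠ d j :=
    ae_all_iff.2 fun i => ae_all_iff.2 fun j => by
      by_cases hij : i = j
      · simp [hij]
      · simpa [hij] using h i j hij
  filter_upwards [h'] with d hd i j hij
  by_contra hne
  exact hd i j hne hij

theorem measurableEmbedding_comp_perm {n : ℕ} (σ : Equiv.Perm (Fin n)) :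
    MeasurableEmbedding fun (d : Fin n → ℝ) i => d (σ i) :=
  (MeasurableEquiv.piCongrLeft (fun _ => ℝ) σ).symm.measurableEmbedding

theorem volume_preserving_comp_perm {n : ℕ} (σ : Equiv.Perm (Fin n)) :
    MeasurePreserving fun (d : Fin n → ℝ) i => d (σ i) :=
  (volume_measurePreserving_piCongrLeft (fun _ => ℝ) σ).symm _

theorem integral_eq_sum_perm {n : ℕ} {h : (Fin n → ℝ) → ℂ} (h_int : Integrable h) :
    ∫ d, h d = ∑ σ : Equiv.Perm (Fin n), ∫ d in {d | StrictMono d}, h fun i => d (σ i) := by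
  set s : Equiv.Perm (Fin n) → Set (Fin n → ℝ) := fun σ => {d | StrictMono fun i => d (σ.symm i)}
  have hs : ∀ σ, MeasurableSet (s σ) := fun σ =>
    (measurableEmbedding_comp_perm σ.symm).measurable (measurableSet_strictMono n)
  have hunion : (⋃ σ, s σ) =ᵐ[volume] Set.univ := by
    refine Filter.eventuallyEq_univ.2 ?_
    filter_upwards [ae_injective n] with d hd
    refine Set.mem_iUnion.2 ⟨(Tuple.sort d).symm, ?_⟩
    exact (Tuple.monotone_sort d).strictMono_of_injective (hd.comp (Tuple.sort d).injective)
  have hdisj : Pairwise (Function.onFun Disjoint s) := fun σ τ hne => by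
    refine Set.disjoint_left.2 fun d hσ hτ => hne ?_
    have heq := Tuple.unique_monotone (f := d) (σ := σ.symm) (τ := τ.symm)
      (StrictMono.monotone hσ) (StrictMono.monotone hτ)
    have hd : Function.Injective d := by
      simpa [Function.comp_def] using (StrictMono.injective hσ).comp σ.injective
    have : σ.symm = τ.symm := Equiv.ext fun i => hd (congrFun heq i)
    simpa using congrArg Equiv.symm this
  rw [← setIntegral_univ, ← setIntegral_congr_set hunion,
    integral_iUnion_fintype hs hdisj fun σ => h_int.integrableOn]
  refine Finset.sum_congr rfl fun σ _ => ?_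
  rw [← (volume_preserving_comp_perm σ).setIntegral_preimage_emb (measurableEmbedding_comp_perm σ)]
  congr 2
  ext d
  simp [s]

/-! ### Bounded invariant functions of bounded support -/

theorem integrable_mul_of_bounded_support {E : Type*} [NormedAddCommGroup E] [ProperSpace E]
    [MeasurableSpace E] [BorelSpace E] {μ : Measure E} [IsFiniteMeasureOnCompacts μ]
    {g k : E → ℂ} {C R : ℝ} (hg : AEStronglyMeasurable g μ) (hC : ∀ x, ‖g x‖ ≤ C)
    (hR : ∀ x, g x ≠ 0 → ‖x‖ ≤ R) (hk : Continuous k) : Integrable (fun x => g x * k x) μ := by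
  have hball := isCompact_closedBall (0 : E) R
  refine (integrableOn_iff_integrable_of_support_subset (s := Metric.closedBall 0 R)
    fun x hx => ?_).1 (IntegrableOn.mul_continuousOn ?_ hk.continuousOn hball)
  · exact mem_closedBall_zero_iff.2 (hR x (left_ne_zero_of_mul hx))
  · exact Measure.integrableOn_of_bounded hball.measure_lt_top.ne hg (ae_of_all _ hC)

/-- The restriction of `Φ` to diagonal matrices with increasing entries, extended by zero. -/
noncomputable def onOrdered {n : ℕ} (Φ : Matrix (Fin n) (Fin n) ℂ → ℂ) : (Fin n → ℝ) → ℂ :=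
  Set.indicator {d | StrictMono d} fun d => Φ (diagonal fun i => (d i : ℂ))

theorem onOrdered_of_strictMono {n : ℕ} (Φ : Matrix (Fin n) (Fin n) ℂ → ℂ) {d : Fin n → ℝ}
    (hd : StrictMono d) : onOrdered Φ d = Φ (diagonal fun i => (d i : ℂ)) :=
  Set.indicator_of_mem (s := {d | StrictMono d}) hd _

theorem onOrdered_of_not_strictMono {n : ℕ} (Φ : Matrix (Fin n) (Fin n) ℂ → ℂ) {d : Fin n → ℝ}
    (hd : ¬StrictMono d) : onOrdered Φ d = 0 :=
  Set.indicator_of_notMem (s := {d | StrictMono d}) hd _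

/-- Measurable unitarily invariant functions with values bounded by `C` that vanish on matrices
with an entry exceeding `R`. -/
structure TameInvariant {n : ℕ} (Φ : Matrix (Fin n) (Fin n) ℂ → ℂ) (C R : ℝ) : Prop where
  invariant : UnitarilyInvariant Φ
  nonneg : 0 ≤ R
  bound : ∀ X, ‖Φ X‖ ≤ C
  support : ∀ X, Φ X ≠ 0 → ∀ i j, ‖X i j‖ ≤ R
  aestronglyMeasurable_hermMat : AEStronglyMeasurable fun v => Φ (hermMat n v)
  aestronglyMeasurable_onOrdered : AEStronglyMeasurable (onOrdered Φ)

namespace TameInvariant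

variable {n : ℕ} {C R : ℝ}

theorem bound_nonneg {Φ : Matrix (Fin n) (Fin n) ℂ → ℂ} (h : TameInvariant Φ C R) : 0 ≤ C :=
  (norm_nonneg _).trans (h.bound 0)

theorem norm_onOrdered_le {Φ : Matrix (Fin n) (Fin n) ℂ → ℂ} (h : TameInvariant Φ C R)
    (d : Fin n → ℝ) : ‖onOrdered Φ d‖ ≤ C := by
  by_cases hd : StrictMono d
  · rw [onOrdered_of_strictMono Φ hd]
    exact h.bound _
  · rw [onOrdered_of_not_strictMono Φ hd, norm_zero]
    exact h.bound_nonneg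

theorem norm_le_of_onOrdered_ne_zero {Φ : Matrix (Fin n) (Fin n) ℂ → ℂ}
    (h : TameInvariant Φ C R) {d : Fin n → ℝ} (hd : onOrdered Φ d ≠ 0) : ‖d‖ ≤ R := by
  refine (pi_norm_le_iff_of_nonneg h.nonneg).2 fun i => ?_
  by_cases hmono : StrictMono d
  · rw [onOrdered_of_strictMono Φ hmono] at hd
    simpa using h.support _ hd i i
  · exact absurd (onOrdered_of_not_strictMono Φ hmono) hd

theorem norm_le_of_hermMat_ne_zero {Φ : Matrix (Fin n) (Fin n) ℂ → ℂ}
    (h : TameInvariant Φ C R) {v : (Fin n → ℝ) × ({ p : Fin n × Fin n // p.1 < p.2 } → ℝ × ℝ)}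
    (hv : Φ (hermMat n v) ≠ 0) : ‖v‖ ≤ R := by
  have hR := h.support _ hv
  refine norm_prod_le_iff.2 ⟨(pi_norm_le_iff_of_nonneg h.nonneg).2 fun i => ?_,
    (pi_norm_le_iff_of_nonneg h.nonneg).2 fun p => ?_⟩
  · simpa [hermMat] using hR i i
  · have hp : hermMat n v p.1.1 p.1.2 = ⟨(v.2 p).1, (v.2 p).2⟩ := by
      simp [hermMat, p.2, Complex.ext_iff]
    have := hR p.1.1 p.1.2
    rw [hp] at this
    exact norm_prod_le_iff.2 ⟨(Complex.abs_re_le_norm _).trans this,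
      (Complex.abs_im_le_norm _).trans this⟩

theorem norm_le_of_bordered_ne_zero {Φ : Matrix (Fin (n + 1)) (Fin (n + 1)) ℂ → ℂ}
    (h : TameInvariant Φ C R) {A : Matrix (Fin n) (Fin n) ℂ} {x : ℝ × (Fin n → ℂ)}
    (hx : Φ (bordered x.1 x.2 A) ≠ 0) : ‖x‖ ≤ R := by
  have hR := h.support _ hx
  refine norm_prod_le_iff.2 ⟨?_, (pi_norm_le_iff_of_nonneg h.nonneg).2 fun i => ?_⟩
  · simpa using hR 0 0
  · simpa using hR 0 i.succ

end TameInvariant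

/-! ### Integrating out the border -/

/-- The partial Fourier integral of `Φ` over the first row and column. -/
noncomputable def borderIntegral {n : ℕ} (Φ : Matrix (Fin (n + 1)) (Fin (n + 1)) ℂ → ℂ) (t : ℝ)
    (A : Matrix (Fin n) (Fin n) ℂ) : ℂ :=
  ∫ x : ℝ × (Fin n → ℂ), Φ (bordered x.1 x.2 A) * Complex.exp (-Complex.I * (x.1 * t))

theorem star_bordered_one_zero {n : ℕ} (U : Matrix (Fin n) (Fin n) ℂ) :
    star (bordered 1 0 U) = bordered 1 0 (star U) := by
  ext i j
  refine Fin.cases ?_ (fun i => ?_) i <;> refine Fin.cases ?_ (fun j => ?_) j <;>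
    simp [star_apply]

theorem bordered_one_zero_mul_mul {n : ℕ} (U A : Matrix (Fin n) (Fin n) ℂ) (c : ℝ)
    (b : Fin n → ℂ) : bordered 1 0 U * bordered c b A * bordered 1 0 (star U) =
      bordered c (b ᵥ* star U) (U * A * star U) := by
  ext i j
  refine Fin.cases ?_ (fun i => ?_) i <;> refine Fin.cases ?_ (fun j => ?_) j <;>
    simp [mul_apply, Fin.sum_univ_succ, vecMul, dotProduct, star_apply, mul_comm]

theorem bordered_one_zero_mem_unitaryGroup {n : ℕ} {U : Matrix (Fin n) (Fin n) ℂ}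
    (hU : U ∈ unitaryGroup (Fin n) ℂ) : bordered 1 0 U ∈ unitaryGroup (Fin (n + 1)) ℂ := by
  have h1 : bordered 1 0 (1 : Matrix (Fin n) (Fin n) ℂ) = 1 := by
    ext i j
    refine Fin.cases ?_ (fun i => ?_) i <;> refine Fin.cases ?_ (fun j => ?_) j <;>
      simp [one_apply, Fin.succ_ne_zero, (Fin.succ_ne_zero _).symm]
  have h := bordered_one_zero_mul_mul U 1 1 0
  rw [zero_vecMul, h1, mul_one, mul_one, (Unitary.mem_iff.1 hU).2, h1] at h
  rw [mem_unitaryGroup_iff, star_bordered_one_zero, h]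

theorem UnitarilyInvariant.borderIntegral {n : ℕ} {Φ : Matrix (Fin (n + 1)) (Fin (n + 1)) ℂ → ℂ}
    (hΦ : UnitarilyInvariant Φ) (t : ℝ) : UnitarilyInvariant (borderIntegral Φ t) := by
  intro U hU A
  have hU' : star U ∈ unitaryGroup (Fin n) ℂ := Unitary.star_mem hU
  have hUU : star U * U = 1 := (Unitary.mem_iff.1 hU).1
  have hmp := (MeasurePreserving.id (volume : Measure ℝ)).prod
    (measurePreserving_vecMul_of_mem_unitaryGroup hU')
  have hinj : Function.Injective fun b : Fin n → ℂ => b ᵥ* star U := fun b b' hb => by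
    simpa [hUU] using congrArg (· ᵥ* U) hb
  have hemb : MeasurableEmbedding (Prod.map (id : ℝ → ℝ) fun b : Fin n → ℂ => b ᵥ* star U) :=
    Continuous.measurableEmbedding (by fun_prop) (Function.injective_id.prodMap hinj)
  have key : ∀ (c : ℝ) (b : Fin n → ℂ),
      Φ (bordered c (b ᵥ* star U) (U * A * star U)) = Φ (bordered c b A) := fun c b => by
    rw [← bordered_one_zero_mul_mul U A c b, ← star_bordered_one_zero]
    exact hΦ _ (bordered_one_zero_mem_unitaryGroup hU) _
  unfold _root_.borderIntegral
  rw [Measure.volume_eq_prod, ← hmp.integral_comp hemb]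
  simp [key]

theorem measurableSet_interlaces (n : ℕ) :
    MeasurableSet {p : (Fin n → ℝ) × (Fin (n + 1) → ℝ) | Interlaces p.1 p.2} := by
  have : {p : (Fin n → ℝ) × (Fin (n + 1) → ℝ) | Interlaces p.1 p.2} =
      ⋂ i, {p | p.2 (Fin.castSucc i) < p.1 i} ∩ {p | p.1 i < p.2 (Fin.succ i)} := by
    ext p
    simp [Interlaces]
  rw [this]
  exact .iInter fun i => (measurableSet_lt (by fun_prop) (by fun_prop)).inter
    (measurableSet_lt (by fun_prop) (by fun_prop))

namespace TameInvariant

variable {n : ℕ} {C R : ℝ} {Φ : Matrix (Fin (n + 1)) (Fin (n + 1)) ℂ → ℂ}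

/-- The border integral at a diagonal matrix, computed by a change of variables from the border to
the eigenvalues of the bordered matrix. -/
theorem borderIntegral_diagonal (h : TameInvariant Φ C R) (t : ℝ) {a : Fin n → ℝ}
    (ha : StrictMono a) :
    borderIntegral Φ t (diagonal fun i => (a i : ℂ)) * vdm n a =
      Real.pi ^ n * ∫ d in {d | Interlaces a d}, onOrdered Φ d * (vdm (n + 1) d *
        Complex.exp (-Complex.I * ((∑ j, (d j : ℂ) - ∑ i, (a i : ℂ)) * t))) := by
  set S : Set (Fin (n + 1) → ℝ) := {d | Interlaces a d} with hS
  have hSm : MeasurableSet S := measurable_prodMk_left (measurableSet_interlaces n)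
  set F : (Fin (n + 1) → ℝ) → ℂ := fun d => onOrdered Φ d *
    Complex.exp (-Complex.I * ((∑ j, (d j : ℂ) - ∑ i, (a i : ℂ)) * t)) with hF
  set f : (Fin (n + 1) → ℝ) → ℂ := fun ρ => F (Function.invFunOn (borderCoords a) S ρ) with hf
  have hinv : ∀ d ∈ S, Function.invFunOn (borderCoords a) S (borderCoords a d) = d := fun d hd =>
    (borderCoords_injOn ha.injective).leftInvOn_invFunOn hd
  have hderiv : ∀ d ∈ S, HasFDerivWithinAt (borderCoords a)
      (toLin' (borderJacobian a d)).toContinuousLinearMap S d := fun d _ =>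
    (hasFDerivAt_borderCoords a d).hasFDerivWithinAt
  have hjac : ∀ d ∈ S, |(toLin' (borderJacobian a d)).toContinuousLinearMap.det| •
      f (borderCoords a d) = ((Real.pi ^ n : ℝ) / vdm n a : ℂ) * (onOrdered Φ d * (vdm (n + 1) d *
        Complex.exp (-Complex.I * ((∑ j, (d j : ℂ) - ∑ i, (a i : ℂ)) * t)))) := fun d hd => by
    rw [hf]
    simp only []
    rw [hinv d hd, ContinuousLinearMap.det, LinearMap.coe_toContinuousLinearMap,
      LinearMap.det_toLin', abs_det_borderJacobian ha (Interlaces.strictMono_right hd), hF,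
      Complex.real_smul]
    push_cast
    ring
  have h_int : IntegrableOn f (borderCoords a '' S) := by
    rw [integrableOn_image_iff_integrableOn_abs_det_fderiv_smul _ hSm hderiv
      (borderCoords_injOn ha.injective), integrableOn_congr_fun hjac hSm]
    have hcont := continuous_vdm (n + 1)
    exact ((integrable_mul_of_bounded_support h.aestronglyMeasurable_onOrdered h.norm_onOrdered_le
      (fun d => h.norm_le_of_onOrdered_ne_zero) (by fun_prop)).const_mul _).integrableOn
  have hmp := measurePreserving_cons_pi_mul_norm_sq n
  rw [← image_borderCoords ha] at hmp
  have hae : ∀ᵐ x : ℝ × (Fin n → ℂ),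
      (Fin.cons x.1 fun i => Real.pi * ‖x.2 i‖ ^ 2 : Fin (n + 1) → ℝ) ∈ borderCoords a '' S := by
    refine hmp.quasiMeasurePreserving.ae (ae_restrict_mem ?_)
    rw [image_borderCoords ha]
    exact measurableSet_setOfPred.2 (Measurable.forall fun i =>
      measurableSet_setOfPred.1 (measurableSet_lt measurable_const (measurable_pi_apply _)))
  have hcongr : borderIntegral Φ t (diagonal fun i => (a i : ℂ)) =
      ∫ x : ℝ × (Fin n → ℂ), f (Fin.cons x.1 fun i => Real.pi * ‖x.2 i‖ ^ 2) := by
    refine integral_congr_ae ?_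
    filter_upwards [hae] with x hx
    have hmem := Function.invFunOn_mem hx
    have heq := Function.invFunOn_eq hx
    set d := Function.invFunOn (borderCoords a) S (Fin.cons x.1 fun i => Real.pi * ‖x.2 i‖ ^ 2)
      with hd
    have hx1 : x.1 = ∑ j, d j - ∑ i, a i := by
      simpa [borderCoords] using (congrFun heq 0).symm
    simp only [hf, hF, ← hd]
    rw [h.invariant.bordered_diagonal ha.injective heq,
      onOrdered_of_strictMono Φ (Interlaces.strictMono_right hmem), hx1]
    push_cast
    rfl
  have hmap := hmp.map_eq
  rw [hcongr, ← integral_map (f := f) hmp.aemeasurable (by rw [hmap]; exact h_int.1), hmap,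
    integral_image_eq_integral_abs_det_fderiv_smul _ hSm hderiv (borderCoords_injOn ha.injective),
    setIntegral_congr_fun hSm hjac, integral_const_mul]
  have hne : (vdm n a : ℂ) ≠ 0 := by exact_mod_cast (vdm_pos ha).ne'
  rw [mul_right_comm, div_mul_cancel₀ _ hne]
  push_cast
  rfl

end TameInvariant

theorem trace_mul_diagonal {n : ℕ} (A : Matrix (Fin n) (Fin n) ℂ) (y : Fin n → ℂ) :
    (A * diagonal y).trace = ∑ i, A i i * y i := by
  simp [trace]

theorem trace_bordered_mul_diagonal {n : ℕ} (c : ℝ) (b : Fin n → ℂ) (A : Matrix (Fin n) (Fin n) ℂ)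
    (y : Fin (n + 1) → ℂ) : (bordered c b A * diagonal y).trace =
      c * y 0 + (A * diagonal fun i : Fin n => y i.succ).trace := by
  simp [trace_mul_diagonal, Fin.sum_univ_succ]

theorem continuous_hermMat (n : ℕ) : Continuous (hermMat n) := by
  refine continuous_matrix fun i j => ?_
  rcases lt_trichotomy i j with h | h | h
  · simp only [hermMat, of_apply, h, dite_true]
    fun_prop
  · simp only [hermMat, of_apply, h, lt_irrefl, dite_false]
    fun_prop
  · simp only [hermMat, of_apply, h, h.not_gt, dite_true, dite_false]
    fun_prop

/-- The restriction of `onOrdered Φ` to tuples interlaced by a given tuple. -/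
noncomputable def onInterlaced {n : ℕ} (Φ : Matrix (Fin (n + 1)) (Fin (n + 1)) ℂ → ℂ) :
    (Fin n → ℝ) × (Fin (n + 1) → ℝ) → ℂ :=
  Set.indicator {p | Interlaces p.1 p.2} fun p => onOrdered Φ p.2

namespace TameInvariant

variable {n : ℕ} {C R : ℝ} {Φ : Matrix (Fin (n + 1)) (Fin (n + 1)) ℂ → ℂ}

theorem aestronglyMeasurable_onInterlaced (h : TameInvariant Φ C R) :
    AEStronglyMeasurable (onInterlaced Φ) (volume.prod volume) :=
  (h.aestronglyMeasurable_onOrdered.comp_snd).indicator (measurableSet_interlaces n)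

theorem norm_onInterlaced_le (h : TameInvariant Φ C R) (p : (Fin n → ℝ) × (Fin (n + 1) → ℝ)) :
    ‖onInterlaced Φ p‖ ≤ C :=
  (norm_indicator_le_norm_self _ p).trans (h.norm_onOrdered_le p.2)

theorem norm_le_of_onInterlaced_ne_zero (h : TameInvariant Φ C R)
    {p : (Fin n → ℝ) × (Fin (n + 1) → ℝ)} (hp : onInterlaced Φ p ≠ 0) : ‖p‖ ≤ R := by
  have hmem : Interlaces p.1 p.2 := Set.mem_of_indicator_ne_zero hp
  have hp2 : ‖p.2‖ ≤ R := by
    refine h.norm_le_of_onOrdered_ne_zero ?_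
    rwa [onInterlaced, Set.indicator_of_mem hmem] at hp
  refine norm_prod_le_iff.2 ⟨(pi_norm_le_iff_of_nonneg h.nonneg).2 fun i => ?_, hp2⟩
  have h1 := (abs_le.1 ((norm_le_pi_norm p.2 i.castSucc).trans hp2)).1
  have h2 := (abs_le.1 ((norm_le_pi_norm p.2 i.succ).trans hp2)).2
  exact abs_le.2 ⟨h1.trans (hmem i).1.le, (hmem i).2.le.trans h2⟩

theorem integrable_onInterlaced_mul (h : TameInvariant Φ C R)
    {k : (Fin n → ℝ) × (Fin (n + 1) → ℝ) → ℂ} (hk : Continuous k) :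
    Integrable (fun p => onInterlaced Φ p * k p) (volume.prod volume) := by
  rw [← Measure.volume_eq_prod]
  exact integrable_mul_of_bounded_support h.aestronglyMeasurable_onInterlaced
    h.norm_onInterlaced_le (fun p => h.norm_le_of_onInterlaced_ne_zero) hk

theorem onOrdered_borderIntegral_mul_vdm (h : TameInvariant Φ C R) (t : ℝ) (a : Fin n → ℝ) :
    onOrdered (borderIntegral Φ t) a * vdm n a =
      Real.pi ^ n * ∫ d, onInterlaced Φ (a, d) * (vdm (n + 1) d *
        Complex.exp (-Complex.I * ((∑ j, (d j : ℂ) - ∑ i, (a i : ℂ)) * t))) := by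
  by_cases ha : StrictMono a
  · have hm : MeasurableSet {d | Interlaces a d} :=
      measurable_prodMk_left (measurableSet_interlaces n)
    rw [onOrdered_of_strictMono _ ha, h.borderIntegral_diagonal t ha, ← integral_indicator hm]
    congr 2
    ext d
    exact Set.indicator_mul_left {d | Interlaces a d} (onOrdered Φ) _
  · have hzero : ∀ d, onInterlaced Φ (a, d) = 0 := fun d =>
      Set.indicator_of_notMem (fun hd => ha (Interlaces.strictMono_left hd)) _
    simp [onOrdered_of_not_strictMono _ ha, hzero]

theorem aestronglyMeasurable_bordered (h : TameInvariant Φ C R) :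
    AEStronglyMeasurable fun p : ((Fin n → ℝ) × ({ p : Fin n × Fin n // p.1 < p.2 } → ℝ × ℝ)) ×
      (ℝ × (Fin n → ℂ)) => Φ (bordered p.2.1 p.2.2 (hermMat n p.1)) := by
  have := h.aestronglyMeasurable_hermMat.comp_measurePreserving (volume_preserving_borderEquiv n)
  simpa only [Function.comp_def, hermMat_borderEquiv] using this

theorem norm_borderIntegral_le (h : TameInvariant Φ C R) (t : ℝ) (A : Matrix (Fin n) (Fin n) ℂ) :
    ‖borderIntegral Φ t A‖ ≤ C * volume.real (Metric.closedBall (0 : ℝ × (Fin n → ℂ)) R) := by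
  unfold borderIntegral
  rw [← setIntegral_eq_integral_of_forall_compl_eq_zero (s := Metric.closedBall 0 R)]
  · refine norm_setIntegral_le_of_norm_le_const
      (isCompact_closedBall _ _).measure_lt_top fun x _ => ?_
    rw [norm_mul, Complex.norm_exp]
    simpa using h.bound _
  · intro x hx
    by_contra hne
    exact hx (mem_closedBall_zero_iff.2 (h.norm_le_of_bordered_ne_zero (left_ne_zero_of_mul hne)))

theorem aestronglyMeasurable_borderIntegral_hermMat (h : TameInvariant Φ C R) (t : ℝ) :
    AEStronglyMeasurable fun w => borderIntegral Φ t (hermMat n w) := by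
  have hexp : AEStronglyMeasurable fun p : ((Fin n → ℝ) ×
      ({ p : Fin n × Fin n // p.1 < p.2 } → ℝ × ℝ)) × (ℝ × (Fin n → ℂ)) =>
      Complex.exp (-Complex.I * (p.2.1 * t)) :=
    Continuous.aestronglyMeasurable (by fun_prop)
  have hmul := h.aestronglyMeasurable_bordered.mul hexp
  rw [Measure.volume_eq_prod] at hmul
  exact hmul.integral_prod_right'

theorem aestronglyMeasurable_onOrdered_borderIntegral (h : TameInvariant Φ C R) (t : ℝ) :
    AEStronglyMeasurable (onOrdered (borderIntegral Φ t)) := by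
  have hcont := continuous_vdm (n + 1)
  have hvdm := continuous_vdm n
  have hK := (h.integrable_onInterlaced_mul (k := fun p => vdm (n + 1) p.2 *
    Complex.exp (-Complex.I * ((∑ j, (p.2 j : ℂ) - ∑ i, (p.1 i : ℂ)) * t)))
      (by fun_prop)).aestronglyMeasurable.integral_prod_right'
  have hV : AEStronglyMeasurable fun a : Fin n → ℝ => ((vdm n a : ℂ))⁻¹ :=
    (Measurable.inv (by fun_prop)).aestronglyMeasurable
  refine ((hK.const_mul ((Real.pi : ℂ) ^ n)).mul hV).congr (ae_of_all _ fun a => ?_)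
  simp only [Pi.mul_apply]
  rw [← h.onOrdered_borderIntegral_mul_vdm t a]
  by_cases ha : StrictMono a
  · rw [mul_inv_cancel_right₀ (by exact_mod_cast (vdm_pos ha).ne')]
  · simp [onOrdered_of_not_strictMono _ ha]

/-- Integrating out the border preserves tameness. -/
protected theorem borderIntegral (h : TameInvariant Φ C R) (t : ℝ) :
    TameInvariant (borderIntegral Φ t)
      (C * volume.real (Metric.closedBall (0 : ℝ × (Fin n → ℂ)) R)) R where
  invariant := h.invariant.borderIntegral t
  nonneg := h.nonneg
  bound := h.norm_borderIntegral_le t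
  support A hA i j := by
    have : ∃ x : ℝ × (Fin n → ℂ), Φ (bordered x.1 x.2 A) ≠ 0 := by
      by_contra! hzero
      exact hA (by simp [borderIntegral, hzero])
    obtain ⟨x, hx⟩ := this
    simpa using h.support _ hx i.succ j.succ
  aestronglyMeasurable_hermMat := h.aestronglyMeasurable_borderIntegral_hermMat t
  aestronglyMeasurable_onOrdered := h.aestronglyMeasurable_onOrdered_borderIntegral t

theorem integral_hermMat_succ (h : TameInvariant Φ C R) (y : Fin (n + 1) → ℝ) :
    ∫ v, Φ (hermMat (n + 1) v) * Complex.exp (-Complex.I *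
        (hermMat (n + 1) v * diagonal fun i => (y i : ℂ)).trace) =
      ∫ w, borderIntegral Φ (y 0) (hermMat n w) * Complex.exp (-Complex.I *
        (hermMat n w * diagonal fun i : Fin n => (y i.succ : ℂ)).trace) := by
  have h_int : Integrable fun v => Φ (hermMat (n + 1) v) * Complex.exp (-Complex.I *
      (hermMat (n + 1) v * diagonal fun i => (y i : ℂ)).trace) := by
    refine integrable_mul_of_bounded_support h.aestronglyMeasurable_hermMat (fun v => h.bound _)
      (fun v => h.norm_le_of_hermMat_ne_zero) ?_
    have := continuous_hermMat (n + 1)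
    fun_prop
  have hmp := volume_preserving_borderEquiv n
  have hemb := (borderEquiv n).measurableEmbedding
  rw [← hmp.integrable_comp_emb hemb] at h_int
  rw [← hmp.integral_comp hemb]
  simp only [Function.comp_def, hermMat_borderEquiv, trace_bordered_mul_diagonal] at h_int ⊢
  rw [Measure.volume_eq_prod] at h_int ⊢
  rw [integral_prod _ h_int]
  refine integral_congr_ae (ae_of_all _ fun w => ?_)
  simp only [borderIntegral]
  rw [← integral_mul_const]
  refine integral_congr_ae (ae_of_all _ fun x => ?_)
  simp only [mul_add, Complex.exp_add]
  ring

end TameInvariant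

/-- The Harish-Chandra formula for tame invariant functions, as an integral over ordered tuples. -/
theorem exists_integral_hermMat_eq (n : ℕ) : ∃ c : ℂ, ∀ (Φ : Matrix (Fin n) (Fin n) ℂ → ℂ)
    (y : Fin n → ℝ) (C R : ℝ), TameInvariant Φ C R → Function.Injective y →
      ∫ v, Φ (hermMat n v) * Complex.exp (-Complex.I *
          (hermMat n v * diagonal fun i => (y i : ℂ)).trace) =
        c * (vdm n y : ℂ)⁻¹ * ∫ d, onOrdered Φ d * (vdm n d * (expMatrix d y).det) := by
  induction n with
  | zero =>
    refine ⟨1, fun Φ y C R _ _ => ?_⟩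
    have hX : ∀ X : Matrix (Fin 0) (Fin 0) ℂ, Φ X = Φ 0 := fun X => by rw [Subsingleton.elim X 0]
    have hord : ∀ d : Fin 0 → ℝ, onOrdered Φ d = Φ 0 := fun d => by
      rw [onOrdered_of_strictMono Φ (Subsingleton.strictMono d), hX]
    have hvol : volume.real (Set.univ : Set ((Fin 0 → ℝ) ×
        ({ p : Fin 0 × Fin 0 // p.1 < p.2 } → ℝ × ℝ))) =
          volume.real (Set.univ : Set (Fin 0 → ℝ)) := by
      rw [Measure.volume_eq_prod, ← Set.univ_prod_univ, measureReal_prod_prod, volume_pi,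
        volume_pi, Measure.pi_of_empty, Measure.pi_of_empty]
      simp
    simp [hX, hord, vdm, trace, hvol]
  | succ n ih =>
    obtain ⟨c, hc⟩ := ih
    refine ⟨c * Real.pi ^ n * (∏ _k : Fin n, (-Complex.I))⁻¹, fun Φ y C R h hy => ?_⟩
    have hvdm := continuous_vdm n
    have hvdm' := continuous_vdm (n + 1)
    have hdet := continuous_expMatrix fun k : Fin n => y k.succ
    rw [h.integral_hermMat_succ, hc _ (fun k => y k.succ) _ _ (h.borderIntegral (y 0))
      (hy.comp (Fin.succ_injective n))]
    have hinner : ∀ a : Fin n → ℝ, onOrdered (borderIntegral Φ (y 0)) a * (vdm n a *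
        (expMatrix a fun k => y k.succ).det) = Real.pi ^ n * ∫ d, onInterlaced Φ (a, d) *
          (vdm (n + 1) d * Complex.exp (-Complex.I * ((∑ j, (d j : ℂ) - ∑ i, (a i : ℂ)) * y 0)) *
            (expMatrix a fun k => y k.succ).det) := fun a => by
      rw [← mul_assoc, h.onOrdered_borderIntegral_mul_vdm, mul_assoc, ← integral_mul_const]
      simp only [mul_assoc]
    have houter : ∀ d, ∫ a, onInterlaced Φ (a, d) *
          (vdm (n + 1) d * Complex.exp (-Complex.I * ((∑ j, (d j : ℂ) - ∑ i, (a i : ℂ)) * y 0)) *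
            (expMatrix a fun k => y k.succ).det) =
        (∏ k : Fin n, (-Complex.I * (y k.succ - y 0)))⁻¹ *
          (onOrdered Φ d * (vdm (n + 1) d * (expMatrix d y).det)) := fun d => by
      by_cases hd : StrictMono d
      · have hm : MeasurableSet {a : Fin n → ℝ | Interlaces a d} :=
          measurable_prodMk_right (measurableSet_interlaces n)
        have hexp : Complex.exp (-Complex.I * ((∑ j, (d j : ℂ)) * y 0)) *
            Complex.exp (Complex.I * (y 0 * ∑ j, (d j : ℂ))) = 1 := by
          rw [← Complex.exp_add, ← Complex.exp_zero]
          congr 1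
          ring
        have hind : ∀ a : Fin n → ℝ, onInterlaced Φ (a, d) * (vdm (n + 1) d *
            Complex.exp (-Complex.I * ((∑ j, (d j : ℂ) - ∑ i, (a i : ℂ)) * y 0)) *
              (expMatrix a fun k => y k.succ).det) =
            onOrdered Φ d * vdm (n + 1) d * Complex.exp (-Complex.I * ((∑ j, (d j : ℂ)) * y 0)) *
              Set.indicator {a : Fin n → ℝ | Interlaces a d} (fun a =>
                Complex.exp (Complex.I * (y 0 * ∑ i, (a i : ℂ))) *
                  (expMatrix a fun k => y k.succ).det) a := fun a => by
          by_cases had : Interlaces a d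
          · rw [onInterlaced, Set.indicator_of_mem (by exact had),
              Set.indicator_of_mem (by exact had),
              show -Complex.I * ((∑ j, (d j : ℂ) - ∑ i, (a i : ℂ)) * y 0) =
                -Complex.I * ((∑ j, (d j : ℂ)) * y 0) + Complex.I * (y 0 * ∑ i, (a i : ℂ)) by ring,
              Complex.exp_add]
            ring
          · rw [onInterlaced, Set.indicator_of_notMem (by exact had),
              Set.indicator_of_notMem (by exact had)]
            ring
        simp_rw [hind]
        rw [integral_const_mul, integral_indicator hm, integral_exp_mul_det_expMatrix hd hy]
        linear_combination (onOrdered Φ d * vdm (n + 1) d *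
          (∏ k : Fin n, (-Complex.I * (y k.succ - y 0)))⁻¹ * (expMatrix d y).det) * hexp
      · have hzero : ∀ a, onInterlaced Φ (a, d) = 0 := fun a =>
          Set.indicator_of_notMem (fun had => hd (Interlaces.strictMono_right had)) _
        simp [onOrdered_of_not_strictMono _ hd, hzero]
    have h_int := h.integrable_onInterlaced_mul (k := fun p => vdm (n + 1) p.2 *
      Complex.exp (-Complex.I * ((∑ j, (p.2 j : ℂ) - ∑ i, (p.1 i : ℂ)) * y 0)) *
        (expMatrix p.1 fun k => y k.succ).det) (by fun_prop)
    simp_rw [hinner]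
    rw [integral_const_mul, integral_integral_swap h_int]
    simp_rw [houter]
    rw [integral_const_mul, vdm_succ y, Finset.prod_mul_distrib]
    push_cast
    rw [mul_inv, mul_inv]
    ring

/-! ### Truncation -/

/-- The truncation of `Φ` in value and in Frobenius norm of the argument. -/
noncomputable def truncate {n : ℕ} (Φ : Matrix (Fin n) (Fin n) ℂ → ℂ) (k : ℕ) :
    Matrix (Fin n) (Fin n) ℂ → ℂ :=
  Set.indicator {X | ‖Φ X‖ ≤ k ∧ (X * star X).trace.re ≤ (k : ℝ) ^ 2} Φ

theorem trace_mul_star_re {n : ℕ} (X : Matrix (Fin n) (Fin n) ℂ) :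
    (X * star X).trace.re = ∑ i, ∑ j, ‖X i j‖ ^ 2 := by
  simp only [trace, diag_apply, mul_apply, star_apply, Complex.re_sum]
  refine Finset.sum_congr rfl fun i _ => Finset.sum_congr rfl fun j _ => ?_
  rw [RCLike.star_def, Complex.mul_conj, Complex.ofReal_re, Complex.normSq_eq_norm_sq]

theorem UnitarilyInvariant.truncate {n : ℕ} {Φ : Matrix (Fin n) (Fin n) ℂ → ℂ}
    (hΦ : UnitarilyInvariant Φ) (k : ℕ) : UnitarilyInvariant (truncate Φ k) := by
  intro U hU X
  have hUU : star U * U = 1 := (Unitary.mem_iff.1 hU).1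
  have htr : (U * X * star U * star (U * X * star U)).trace = (X * star X).trace := by
    rw [star_mul, star_mul, star_star, ← mul_assoc, mul_assoc (U * X) (star U) U, hUU, mul_one,
      mul_assoc U, ← mul_assoc, trace_mul_comm, ← mul_assoc,
      mul_assoc (star X), hUU, mul_one, trace_mul_comm]
  simp only [_root_.truncate, Set.indicator, Set.mem_ofPred_eq, hΦ U hU X, htr]
  congr

theorem norm_truncate_le {n : ℕ} (Φ : Matrix (Fin n) (Fin n) ℂ → ℂ) (k : ℕ)
    (X : Matrix (Fin n) (Fin n) ℂ) : ‖truncate Φ k X‖ ≤ ‖Φ X‖ :=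
  norm_indicator_le_norm_self _ X

theorem eventually_truncate_eq {n : ℕ} (Φ : Matrix (Fin n) (Fin n) ℂ → ℂ)
    (X : Matrix (Fin n) (Fin n) ℂ) : ∀ᶠ k in Filter.atTop, truncate Φ k X = Φ X := by
  have h1 := (tendsto_natCast_atTop_atTop (R := ℝ)).eventually_ge_atTop ‖Φ X‖
  have h2 := ((Filter.tendsto_pow_atTop two_ne_zero).comp
    (tendsto_natCast_atTop_atTop (R := ℝ))).eventually_ge_atTop (X * star X).trace.re
  filter_upwards [h1, h2] with k hk1 hk2
  exact Set.indicator_of_mem (s := {X | ‖Φ X‖ ≤ k ∧ (X * star X).trace.re ≤ (k : ℝ) ^ 2})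
    ⟨hk1, hk2⟩ _

theorem onOrdered_truncate {n : ℕ} (Φ : Matrix (Fin n) (Fin n) ℂ → ℂ) (k : ℕ) :
    onOrdered (truncate Φ k) = Set.indicator {d : Fin n → ℝ | ‖onOrdered Φ d‖ ≤ k ∧
      ((diagonal fun i => (d i : ℂ)) * star (diagonal fun i => (d i : ℂ))).trace.re ≤ (k : ℝ) ^ 2}
        (onOrdered Φ) := by
  ext d
  by_cases hd : StrictMono d
  · rw [onOrdered_of_strictMono _ hd]
    simp only [truncate, Set.indicator, Set.mem_ofPred_eq, onOrdered_of_strictMono Φ hd]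
    congr
  · rw [onOrdered_of_not_strictMono _ hd, Set.indicator_apply_eq_zero.2]
    exact fun _ => onOrdered_of_not_strictMono _ hd

theorem tameInvariant_truncate {n : ℕ} {Φ : Matrix (Fin n) (Fin n) ℂ → ℂ}
    (hΦ : UnitarilyInvariant Φ) (hherm : AEStronglyMeasurable fun v => Φ (hermMat n v))
    (hord : AEStronglyMeasurable (onOrdered Φ)) (k : ℕ) :
    TameInvariant (truncate Φ k) k k where
  invariant := hΦ.truncate k
  nonneg := k.cast_nonneg
  bound X := by
    rw [truncate, Set.indicator]
    split_ifs with h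
    · exact h.1
    · simp
  support X hX i j := by
    have hmem := (Set.mem_of_indicator_ne_zero hX).2
    rw [trace_mul_star_re] at hmem
    refine (sq_le_sq₀ (norm_nonneg _) k.cast_nonneg).1 ?_
    refine le_trans ?_ hmem
    exact (Finset.single_le_sum (f := fun j => ‖X i j‖ ^ 2) (fun _ _ => by positivity)
      (Finset.mem_univ j)).trans (Finset.single_le_sum (f := fun i => ∑ j, ‖X i j‖ ^ 2)
        (fun _ _ => by positivity) (Finset.mem_univ i))
  aestronglyMeasurable_hermMat := by
    have hc := continuous_hermMat n
    have htr : Continuous fun v => (hermMat n v * star (hermMat n v)).trace.re := by fun_prop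
    have hs : NullMeasurableSet {v | ‖Φ (hermMat n v)‖ ≤ k ∧
        (hermMat n v * star (hermMat n v)).trace.re ≤ (k : ℝ) ^ 2} volume :=
      (nullMeasurableSet_le hherm.norm.aemeasurable aemeasurable_const).inter
        (measurableSet_le htr.measurable measurable_const).nullMeasurableSet
    exact hherm.indicator₀ hs
  aestronglyMeasurable_onOrdered := by
    rw [onOrdered_truncate]
    have htr : Continuous fun d : Fin n → ℝ =>
        ((diagonal fun i => (d i : ℂ)) * star (diagonal fun i => (d i : ℂ))).trace.re := by
      fun_prop
    have hs : NullMeasurableSet {d : Fin n → ℝ | ‖onOrdered Φ d‖ ≤ k ∧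
        ((diagonal fun i => (d i : ℂ)) * star (diagonal fun i => (d i : ℂ))).trace.re ≤
          (k : ℝ) ^ 2} volume :=
      (nullMeasurableSet_le hord.norm.aemeasurable aemeasurable_const).inter
        (measurableSet_le htr.measurable measurable_const).nullMeasurableSet
    exact hord.indicator₀ hs

/-! ### The formula -/

theorem norm_exp_neg_I_mul_sum {n : ℕ} (d y : Fin n → ℝ) :
    ‖Complex.exp (-Complex.I * ∑ j, (d j : ℂ) * (y j : ℂ))‖ = 1 := by
  have : (∑ j, (d j : ℂ) * (y j : ℂ)) = ((∑ j, d j * y j : ℝ) : ℂ) := by push_cast; rfl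
  rw [this, Complex.norm_exp]
  simp

theorem aestronglyMeasurable_onOrdered_of_integrable {n : ℕ} {Φ : Matrix (Fin n) (Fin n) ℂ → ℂ}
    {y : Fin n → ℝ} (h : Integrable fun d : Fin n → ℝ => Φ (diagonal fun i => (d i : ℂ)) *
      Complex.exp (-Complex.I * ∑ j, (d j : ℂ) * (y j : ℂ)) * (vdm n d : ℂ)) :
    AEStronglyMeasurable (onOrdered Φ) := by
  have hvdm := continuous_vdm n
  have hinv : AEStronglyMeasurable fun d : Fin n → ℝ =>
      (Complex.exp (-Complex.I * ∑ j, (d j : ℂ) * (y j : ℂ)) * (vdm n d : ℂ))⁻¹ :=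
    (Measurable.inv (by fun_prop)).aestronglyMeasurable
  refine ((h.aestronglyMeasurable.mul hinv).indicator (measurableSet_strictMono n)).congr
    (ae_of_all _ fun d => ?_)
  by_cases hd : StrictMono d
  · have hne : (vdm n d : ℂ) ≠ 0 := by exact_mod_cast (vdm_pos hd).ne'
    rw [onOrdered_of_strictMono Φ hd, Set.indicator_of_mem (by exact hd), Pi.mul_apply,
      mul_assoc (Φ _), mul_inv_cancel_right₀ (mul_ne_zero (Complex.exp_ne_zero _) hne)]
  · rw [onOrdered_of_not_strictMono Φ hd, Set.indicator_of_notMem (by exact hd)]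

/-- Summing over the orderings of the eigenvalues. -/
theorem UnitarilyInvariant.integral_onOrdered {n : ℕ} {Φ : Matrix (Fin n) (Fin n) ℂ → ℂ}
    (hΦ : UnitarilyInvariant Φ) {y : Fin n → ℝ}
    (h : Integrable fun d : Fin n → ℝ => Φ (diagonal fun i => (d i : ℂ)) *
      Complex.exp (-Complex.I * ∑ j, (d j : ℂ) * (y j : ℂ)) * (vdm n d : ℂ)) :
    ∫ d, onOrdered Φ d * (vdm n d * (expMatrix d y).det) =
      ∫ d : Fin n → ℝ, Φ (diagonal fun i => (d i : ℂ)) *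
        Complex.exp (-Complex.I * ∑ j, (d j : ℂ) * (y j : ℂ)) * (vdm n d : ℂ) := by
  rw [integral_eq_sum_perm h, ← integral_finsetSum, ← integral_indicator (measurableSet_strictMono n)]
  · congr 1
    ext d
    by_cases hd : StrictMono d
    · rw [onOrdered_of_strictMono Φ hd, Set.indicator_of_mem (by exact hd), det_apply,
        Finset.mul_sum, Finset.mul_sum]
      refine Finset.sum_congr rfl fun σ _ => ?_
      rw [hΦ.diagonal_comp_perm, vdm_comp_perm, Finset.mul_sum, Complex.exp_sum, Units.smul_def,
        zsmul_eq_mul]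
      simp only [expMatrix, of_apply]
      push_cast
      ring
    · rw [onOrdered_of_not_strictMono Φ hd, zero_mul, Set.indicator_of_notMem (by exact hd)]
  · intro σ _
    exact (((volume_preserving_comp_perm σ).integrable_comp_emb
      (measurableEmbedding_comp_perm σ)).2 h).integrableOn

theorem integral_hermMat_eq_of_forall_tame {n : ℕ} {c : ℂ} {y : Fin n → ℝ}
    (hc : ∀ (Φ : Matrix (Fin n) (Fin n) ℂ → ℂ) (C R : ℝ), TameInvariant Φ C R →
      ∫ v, Φ (hermMat n v) * Complex.exp (-Complex.I *
          (hermMat n v * diagonal fun i => (y i : ℂ)).trace) =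
        c * ∫ d, onOrdered Φ d * (vdm n d * (expMatrix d y).det))
    {Φ : Matrix (Fin n) (Fin n) ℂ → ℂ} (hΦ : UnitarilyInvariant Φ)
    (h1 : Integrable fun v => Φ (hermMat n v) * Complex.exp (-Complex.I *
      (hermMat n v * diagonal fun i => (y i : ℂ)).trace))
    (h2 : Integrable fun d : Fin n → ℝ => Φ (diagonal fun i => (d i : ℂ)) *
      Complex.exp (-Complex.I * ∑ j, (d j : ℂ) * (y j : ℂ)) * (vdm n d : ℂ)) :
    ∫ v, Φ (hermMat n v) * Complex.exp (-Complex.I *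
        (hermMat n v * diagonal fun i => (y i : ℂ)).trace) =
      c * ∫ d, onOrdered Φ d * (vdm n d * (expMatrix d y).det) := by
  have hcont := continuous_hermMat n
  have hvdm := continuous_vdm n
  have hexp := continuous_expMatrix y
  have hherm : AEStronglyMeasurable fun v => Φ (hermMat n v) := by
    have hinv : AEStronglyMeasurable fun v => (Complex.exp (-Complex.I *
        (hermMat n v * diagonal fun i => (y i : ℂ)).trace))⁻¹ :=
      (Measurable.inv (Continuous.measurable (by fun_prop))).aestronglyMeasurable
    refine (h1.aestronglyMeasurable.mul hinv).congr (ae_of_all _ fun v => ?_)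
    rw [Pi.mul_apply, mul_inv_cancel_right₀ (Complex.exp_ne_zero _)]
  have hord := aestronglyMeasurable_onOrdered_of_integrable h2
  have htame := tameInvariant_truncate hΦ hherm hord
  have hlim1 : Filter.Tendsto (fun k => ∫ v, truncate Φ k (hermMat n v) * Complex.exp (-Complex.I *
      (hermMat n v * diagonal fun i => (y i : ℂ)).trace)) Filter.atTop
      (nhds (∫ v, Φ (hermMat n v) * Complex.exp (-Complex.I *
        (hermMat n v * diagonal fun i => (y i : ℂ)).trace))) := by
    refine tendsto_integral_of_dominated_convergence _ (fun k => ?_) h1.norm (fun k => ?_) ?_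
    · exact (htame k).aestronglyMeasurable_hermMat.mul
        (Continuous.aestronglyMeasurable (by fun_prop))
    · refine ae_of_all _ fun v => ?_
      rw [norm_mul, norm_mul]
      gcongr
      exact norm_truncate_le Φ k _
    · refine ae_of_all _ fun v => tendsto_nhds_of_eventually_eq ?_
      filter_upwards [eventually_truncate_eq Φ (hermMat n v)] with k hk
      rw [hk]
  have hlim2 : Filter.Tendsto (fun k => ∫ d, onOrdered (truncate Φ k) d *
      (vdm n d * (expMatrix d y).det)) Filter.atTop
      (nhds (∫ d, onOrdered Φ d * (vdm n d * (expMatrix d y).det))) := by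
    refine tendsto_integral_of_dominated_convergence _ (fun k => ?_)
      (h2.norm.mul_const (n.factorial : ℝ)) (fun k => ?_) ?_
    · exact (htame k).aestronglyMeasurable_onOrdered.mul
        (Continuous.aestronglyMeasurable (by fun_prop))
    · refine ae_of_all _ fun d => ?_
      rw [norm_mul, norm_mul, norm_mul, norm_mul, norm_exp_neg_I_mul_sum, mul_one, ← mul_assoc]
      gcongr
      · by_cases hd : StrictMono d
        · rw [onOrdered_of_strictMono _ hd]
          exact norm_truncate_le Φ k _
        · rw [onOrdered_of_not_strictMono _ hd, norm_zero]
          exact norm_nonneg _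
      · exact norm_det_expMatrix_le d y
    · refine ae_of_all _ fun d => tendsto_nhds_of_eventually_eq ?_
      by_cases hd : StrictMono d
      · filter_upwards [eventually_truncate_eq Φ (diagonal fun i => (d i : ℂ))] with k hk
        rw [onOrdered_of_strictMono _ hd, onOrdered_of_strictMono _ hd, hk]
      · exact .of_forall fun k => by
          rw [onOrdered_of_not_strictMono _ hd, onOrdered_of_not_strictMono _ hd]
  refine tendsto_nhds_unique hlim1 ((hlim2.const_mul c).congr fun k => ?_)
  exact (hc _ _ _ (htame k)).symm

/-- (Harish-Chandra formula.)  There is a constant `c_N`, depending only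
on `N`, such that for every unitary-conjugation-invariant `Φ` and every real diagonal
`Y = diag(y)` with pairwise distinct entries (under the stated integrability assumptions):
`∫_{H_N} Φ(X) e^{−i tr(XY)} dX = c_N V(y)⁻¹ ∫_{ℝ^N} Φ(diag d) e^{−i Σ d_j y_j} V(d) dd`. -/
theorem harish_chandra_formula (N : ℕ) (hN : 1 ≤ N) :
    ∃ cN : ℂ,
      ∀ (Φ : Matrix (Fin N) (Fin N) ℂ → ℂ) (y : Fin N → ℝ),
        (∀ U ∈ Matrix.unitaryGroup (Fin N) ℂ, ∀ X, Φ (U * X * star U) = Φ X) →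
        Function.Injective y →
        Integrable (fun v => Φ (hermMat N v) *
          Complex.exp (-Complex.I *
            (hermMat N v * Matrix.diagonal fun i => (y i : ℂ)).trace)) →
        Integrable (fun d : Fin N → ℝ =>
          Φ (Matrix.diagonal fun i => (d i : ℂ)) *
            Complex.exp (-Complex.I * ∑ j, (d j : ℂ) * (y j : ℂ)) * (vdm N d : ℂ)) →
        ∫ v, Φ (hermMat N v) *
            Complex.exp (-Complex.I *
              (hermMat N v * Matrix.diagonal fun i => (y i : ℂ)).trace)
          = cN * ((vdm N y : ℂ))⁻¹ *
              ∫ d : Fin N → ℝ,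
                Φ (Matrix.diagonal fun i => (d i : ℂ)) *
                  Complex.exp (-Complex.I * ∑ j, (d j : ℂ) * (y j : ℂ)) * (vdm N d : ℂ) := by
  obtain ⟨c, hc⟩ := exists_integral_hermMat_eq N
  refine ⟨c, fun Φ y hΦ hy h1 h2 => ?_⟩
  rw [integral_hermMat_eq_of_forall_tame (fun Φ C R h => hc Φ y C R h hy) hΦ h1 h2,
    UnitarilyInvariant.integral_onOrdered hΦ h2]
end
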